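/- arXiv:math/0512606 — 2 statements merged into one kernel-verified Lean document; each statement's English description precedes it below -/
import Mathlib

section
/- The functions ch₁ and ch₂ are linearly independent over ℂ and each of y = ch₁ and y = ch₂ satisfies the second-order differential equation (q d/dq)²y + 2·G₂·(q d/dq)y − (11/5)·G₄·y = 0 on ℍ; i.e., ch₁ and ch₂ form a fundamental system of solutions of Θ²y − (11/5)G₄ y = 0. -/
open Complex

/-- The Ramanujan derivative `(q d/dq) f = (2πi)⁻¹ df/dτ`. -/
noncomputable def ramD (f : ℂ → ℂ) : ℂ → ℂ := fun τ => (2 * (Real.pi : ℂ) * I)⁻¹ * deriv f τ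

/-- The Eisenstein series `G₂(τ) = −1/12 + 2∑_{n≥1} n qⁿ/(1−qⁿ)`, `q = e^{2πiτ}`. -/
noncomputable def GTwo (τ : ℂ) : ℂ :=
  -(1 / 12) + 2 * ∑' n : ℕ, ((n : ℂ) + 1) * Complex.exp (2 * (Real.pi : ℂ) * I * τ) ^ (n + 1) /
    (1 - Complex.exp (2 * (Real.pi : ℂ) * I * τ) ^ (n + 1))

/-- The Eisenstein series `G₄(τ) = 1/720 + (1/3)∑_{n≥1} n³ qⁿ/(1−qⁿ)`, `q = e^{2πiτ}`. -/
noncomputable def GFour (τ : ℂ) : ℂ :=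
  1 / 720 + (1 / 3) * ∑' n : ℕ, ((n : ℂ) + 1) ^ 3 *
    Complex.exp (2 * (Real.pi : ℂ) * I * τ) ^ (n + 1) /
      (1 - Complex.exp (2 * (Real.pi : ℂ) * I * τ) ^ (n + 1))

/-- The Rogers–Ramanujan character
`ch₁(τ) = e^{2πi(11/60)τ} ∏_{n≥0} 1/((1−q^{5n+2})(1−q^{5n+3}))`, `q = e^{2πiτ}`. -/
noncomputable def chOne (τ : ℂ) : ℂ :=
  Complex.exp (2 * (Real.pi : ℂ) * I * (11 / 60) * τ) *
    ∏' n : ℕ, ((1 - Complex.exp (2 * (Real.pi : ℂ) * I * τ) ^ (5 * n + 2))⁻¹ *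
      (1 - Complex.exp (2 * (Real.pi : ℂ) * I * τ) ^ (5 * n + 3))⁻¹)

/-- The Rogers–Ramanujan character
`ch₂(τ) = e^{−2πi(1/60)τ} ∏_{n≥0} 1/((1−q^{5n+1})(1−q^{5n+4}))`, `q = e^{2πiτ}`. -/
noncomputable def chTwo (τ : ℂ) : ℂ :=
  Complex.exp (-(2 * (Real.pi : ℂ) * I * (1 / 60) * τ)) *
    ∏' n : ℕ, ((1 - Complex.exp (2 * (Real.pi : ℂ) * I * τ) ^ (5 * n + 1))⁻¹ *
      (1 - Complex.exp (2 * (Real.pi : ℂ) * I * τ) ^ (5 * n + 4))⁻¹)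

/-- The upper half-plane as a subset of `ℂ`. -/
def UHP : Set ℂ := {z : ℂ | 0 < z.im}


/-! ### Integer part: a Liouville-type weight function modulo 5 -/

/-- Indicator of the residues `±2` modulo 5. -/
def rrX (r : ℕ) : ℤ := if r = 2 ∨ r = 3 then 1 else 0

/-- Square coefficient table. -/
def rrAl (r s : ℕ) : ℤ :=
  if s = 0 then 5 * rrX r else 2 + 6 * rrX s

/-- Mixed coefficient table. -/
def rrBe (r s : ℕ) : ℤ :=
  match r, s with
  | 0, 2 => 5 | 0, 3 => 5 | 2, 0 => 5 | 3, 0 => 5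
  | 1, 1 => -4 | 4, 4 => -4 | 1, 4 => 4 | 4, 1 => 4
  | 1, 2 => 2 | 2, 1 => 2 | 3, 4 => 2 | 4, 3 => 2
  | 1, 3 => 8 | 3, 1 => 8 | 2, 4 => 8 | 4, 2 => 8
  | 2, 2 => 14 | 3, 3 => 14 | 2, 3 => 11 | 3, 2 => 11
  | _, _ => 0

/-- The piecewise quadratic form. -/
def rrP (r s : ℕ) (a b : ℤ) : ℤ := rrAl r s * a ^ 2 + rrBe r s * (a * b) + rrAl s r * b ^ 2

/-- The weight of the convolution sum. -/
def rrW (r s : ℕ) : ℤ := 2 * rrX r + 2 * rrX s + rrX r * rrX s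

lemma rrP_rel (r s : ℕ) (hr : r < 5) (hs : s < 5) (a b : ℤ) :
    rrP r ((r + s) % 5) a (a + b) - rrP r s a b = 5 * (a * (a + b) * rrW r ((r + s) % 5)) := by
  interval_cases r <;> interval_cases s <;> simp [rrP, rrAl, rrBe, rrW, rrX] <;> ring

lemma rrP_sym (r s : ℕ) (hr : r < 5) (hs : s < 5) (a b : ℤ) : rrP r s a b = rrP s r b a := by
  interval_cases r <;> interval_cases s <;> simp [rrP, rrAl, rrBe, rrX] <;> ring

lemma rrP_diag (r : ℕ) (hr : r < 5) (a : ℤ) :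
    5 * (a * a * rrW r r) - rrP r r a a = -5 * (a ^ 2 * rrX r) := by
  interval_cases r <;> simp [rrP, rrAl, rrBe, rrW, rrX] <;> ring

lemma rrP_bound (r s : ℕ) (hr : r < 5) (hs : s < 5) (a b : ℤ) (ha : 1 ≤ a) (hb : 1 ≤ b) :
    |rrP r s a b| ≤ 30 * (a ^ 2 * b ^ 2) := by
  have h1 : a ^ 2 ≤ a ^ 2 * b ^ 2 := le_mul_of_one_le_right (sq_nonneg a) (one_le_pow₀ hb)
  have h2 : b ^ 2 ≤ a ^ 2 * b ^ 2 := le_mul_of_one_le_left (sq_nonneg b) (one_le_pow₀ ha)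
  have h3 : a * b ≤ a ^ 2 * b ^ 2 := by nlinarith [mul_pos (show 0 < a by omega) (show 0 < b by omega)]
  have h4 : 0 < a * b := by positivity
  have h5 : 0 < a ^ 2 := by positivity
  have h6 : 0 < b ^ 2 := by positivity
  rw [abs_le]
  interval_cases r <;> interval_cases s <;> simp only [rrP, rrAl, rrBe, rrX] <;> constructor <;> norm_num <;> linarith

/-- The weight function at natural numbers. -/
def rrF (t a b : ℕ) : ℤ := rrP (t * a % 5) (t * b % 5) a b

lemma rr_step (t ρ j n : ℕ) (N : ℤ) :
    ∑ i ∈ Finset.range (5 * j + n), rrP (t * i % 5) (t * (ρ + 4 * i) % 5) i (N - i) =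
    ∑ i ∈ Finset.range (5 * j), rrP (t * i % 5) (t * (ρ + 4 * i) % 5) i (N - i) +
    ∑ s ∈ Finset.range n, rrP (t * s % 5) (t * (ρ + 4 * s) % 5) (5 * j + s) (N - (5 * j + s)) := by
  rw [Finset.sum_range_add]
  congr 1
  refine Finset.sum_congr rfl fun s _ => ?_
  have h1 : t * (5 * j + s) % 5 = t * s % 5 := by
    rw [show t * (5 * j + s) = t * s + 5 * (t * j) by ring]; simp
  have h2 : t * (ρ + 4 * (5 * j + s)) % 5 = t * (ρ + 4 * s) % 5 := by
    rw [show t * (ρ + 4 * (5 * j + s)) = t * (ρ + 4 * s) + 5 * (4 * (t * j)) by ring]; simp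
  rw [h1, h2]; push_cast; rfl

lemma rr_sum_1_0 (N : ℤ) (j : ℕ) :
    3 * ∑ i ∈ Finset.range (5 * j), rrP (1 * i % 5) (1 * (0 + 4 * i) % 5) i (N - i) =
      250 * (j : ℤ) ^ 3 + (0) * (j : ℤ) ^ 2 + (-55) * j + N * ((-75) * (j : ℤ) ^ 2 + (0) * j) + 60 * N ^ 2 * j := by
  induction j with
  | zero => simp
  | succ j ih =>
    rw [mul_add_one, rr_step, mul_add, ih]
    simp [Finset.sum_range_succ, rrP, rrAl, rrBe, rrX]
    ring

lemma rr_sum_1_1 (N : ℤ) (j : ℕ) :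
    3 * ∑ i ∈ Finset.range (5 * j), rrP (1 * i % 5) (1 * (1 + 4 * i) % 5) i (N - i) =
      250 * (j : ℤ) ^ 3 + (-75) * (j : ℤ) ^ 2 + (5) * j + N * ((-75) * (j : ℤ) ^ 2 + (45) * j) + 60 * N ^ 2 * j := by
  induction j with
  | zero => simp
  | succ j ih =>
    rw [mul_add_one, rr_step, mul_add, ih]
    simp [Finset.sum_range_succ, rrP, rrAl, rrBe, rrX]
    ring

lemma rr_sum_1_2 (N : ℤ) (j : ℕ) :
    3 * ∑ i ∈ Finset.range (5 * j), rrP (1 * i % 5) (1 * (2 + 4 * i) % 5) i (N - i) =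
      1000 * (j : ℤ) ^ 3 + (-300) * (j : ℤ) ^ 2 + (20) * j + N * ((-300) * (j : ℤ) ^ 2 + (60) * j) + 75 * N ^ 2 * j := by
  induction j with
  | zero => simp
  | succ j ih =>
    rw [mul_add_one, rr_step, mul_add, ih]
    simp [Finset.sum_range_succ, rrP, rrAl, rrBe, rrX]
    ring

lemma rr_sum_1_3 (N : ℤ) (j : ℕ) :
    3 * ∑ i ∈ Finset.range (5 * j), rrP (1 * i % 5) (1 * (3 + 4 * i) % 5) i (N - i) =
      1000 * (j : ℤ) ^ 3 + (-300) * (j : ℤ) ^ 2 + (20) * j + N * ((-300) * (j : ℤ) ^ 2 + (15) * j) + 75 * N ^ 2 * j := by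
  induction j with
  | zero => simp
  | succ j ih =>
    rw [mul_add_one, rr_step, mul_add, ih]
    simp [Finset.sum_range_succ, rrP, rrAl, rrBe, rrX]
    ring

lemma rr_sum_1_4 (N : ℤ) (j : ℕ) :
    3 * ∑ i ∈ Finset.range (5 * j), rrP (1 * i % 5) (1 * (4 + 4 * i) % 5) i (N - i) =
      250 * (j : ℤ) ^ 3 + (-75) * (j : ℤ) ^ 2 + (5) * j + N * ((-75) * (j : ℤ) ^ 2 + (-45) * j) + 60 * N ^ 2 * j := by
  induction j with
  | zero => simp
  | succ j ih =>
    rw [mul_add_one, rr_step, mul_add, ih]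
    simp [Finset.sum_range_succ, rrP, rrAl, rrBe, rrX]
    ring

lemma rr_sum_2_0 (N : ℤ) (j : ℕ) :
    3 * ∑ i ∈ Finset.range (5 * j), rrP (2 * i % 5) (2 * (0 + 4 * i) % 5) i (N - i) =
      250 * (j : ℤ) ^ 3 + (0) * (j : ℤ) ^ 2 + (5) * j + N * ((-75) * (j : ℤ) ^ 2 + (0) * j) + 60 * N ^ 2 * j := by
  induction j with
  | zero => simp
  | succ j ih =>
    rw [mul_add_one, rr_step, mul_add, ih]
    simp [Finset.sum_range_succ, rrP, rrAl, rrBe, rrX]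
    ring

lemma rr_sum_2_1 (N : ℤ) (j : ℕ) :
    3 * ∑ i ∈ Finset.range (5 * j), rrP (2 * i % 5) (2 * (1 + 4 * i) % 5) i (N - i) =
      1000 * (j : ℤ) ^ 3 + (-300) * (j : ℤ) ^ 2 + (20) * j + N * ((-300) * (j : ℤ) ^ 2 + (15) * j) + 75 * N ^ 2 * j := by
  induction j with
  | zero => simp
  | succ j ih =>
    rw [mul_add_one, rr_step, mul_add, ih]
    simp [Finset.sum_range_succ, rrP, rrAl, rrBe, rrX]
    ring

lemma rr_sum_2_2 (N : ℤ) (j : ℕ) :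
    3 * ∑ i ∈ Finset.range (5 * j), rrP (2 * i % 5) (2 * (2 + 4 * i) % 5) i (N - i) =
      250 * (j : ℤ) ^ 3 + (-75) * (j : ℤ) ^ 2 + (5) * j + N * ((-75) * (j : ℤ) ^ 2 + (-15) * j) + 60 * N ^ 2 * j := by
  induction j with
  | zero => simp
  | succ j ih =>
    rw [mul_add_one, rr_step, mul_add, ih]
    simp [Finset.sum_range_succ, rrP, rrAl, rrBe, rrX]
    ring

lemma rr_sum_2_3 (N : ℤ) (j : ℕ) :
    3 * ∑ i ∈ Finset.range (5 * j), rrP (2 * i % 5) (2 * (3 + 4 * i) % 5) i (N - i) =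
      250 * (j : ℤ) ^ 3 + (-75) * (j : ℤ) ^ 2 + (5) * j + N * ((-75) * (j : ℤ) ^ 2 + (15) * j) + 60 * N ^ 2 * j := by
  induction j with
  | zero => simp
  | succ j ih =>
    rw [mul_add_one, rr_step, mul_add, ih]
    simp [Finset.sum_range_succ, rrP, rrAl, rrBe, rrX]
    ring

lemma rr_sum_2_4 (N : ℤ) (j : ℕ) :
    3 * ∑ i ∈ Finset.range (5 * j), rrP (2 * i % 5) (2 * (4 + 4 * i) % 5) i (N - i) =
      1000 * (j : ℤ) ^ 3 + (-300) * (j : ℤ) ^ 2 + (20) * j + N * ((-300) * (j : ℤ) ^ 2 + (60) * j) + 75 * N ^ 2 * j := by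
  induction j with
  | zero => simp
  | succ j ih =>
    rw [mul_add_one, rr_step, mul_add, ih]
    simp [Finset.sum_range_succ, rrP, rrAl, rrBe, rrX]
    ring

lemma rr_range (t n : ℕ) :
    ∑ i ∈ Finset.range n, rrF t (i + 1) (n - 1 - i + 1) =
      ∑ i ∈ Finset.range (n + 1), rrP (t * i % 5) (t * ((n + 1) % 5 + 4 * i) % 5) i ((n + 1 : ℕ) - i)
      - rrP 0 (t * (n + 1) % 5) 0 (n + 1 : ℕ) := by
  rw [Finset.sum_range_succ']
  simp only [mul_zero, Nat.zero_mod, add_zero, Nat.cast_zero, sub_zero]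
  have h0 : t * ((n + 1) % 5) % 5 = t * (n + 1) % 5 := by simp [Nat.mul_mod]
  rw [h0, add_sub_cancel_right]
  refine Finset.sum_congr rfl fun i hi => ?_
  have hi : i < n := Finset.mem_range.mp hi
  obtain ⟨m, rfl⟩ : ∃ m, n = i + 1 + m := ⟨n - (i + 1), by omega⟩
  have e1 : i + 1 + m - 1 - i + 1 = m + 1 := by omega
  have e2 : t * ((i + 1 + m + 1) % 5 + 4 * (i + 1)) % 5 = t * (m + 1) % 5 := by
    rw [Nat.mul_mod, show ((i + 1 + m + 1) % 5 + 4 * (i + 1)) % 5 = (m + 1) % 5 by omega,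
      ← Nat.mul_mod]
  rw [rrF, e1, e2]
  congr 1
  push_cast; ring

lemma rr_total_one (n : ℕ) :
    3 * ∑ i ∈ Finset.range n, rrF 1 (i + 1) (n - 1 - i + 1) =
      -3 * (n + 1) * rrX (1 * (n + 1) % 5) - 11 * ((n + 1) - (n + 1) ^ 3)
        - 15 * (n + 1) ^ 2 * rrX (1 * (n + 1) % 5) := by
  rw [rr_range, mul_sub]
  obtain ⟨j, s, hs, h⟩ : ∃ j s, s < 5 ∧ n + 1 = 5 * j + s :=
    ⟨(n + 1) / 5, (n + 1) % 5, Nat.mod_lt _ (by norm_num), by omega⟩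
  have hn : (n : ℤ) = 5 * j + s - 1 := by omega
  have hm : (5 * j + s) % 5 = s := by omega
  have hm2 : 1 * (5 * j + s) % 5 = 1 * s % 5 := by omega
  rw [h, hm, hm2, hn, rr_step, mul_add]
  interval_cases s
  · rw [rr_sum_1_0]; simp [Finset.sum_range_succ, rrP, rrAl, rrBe, rrX]; ring
  · rw [rr_sum_1_1]; simp [Finset.sum_range_succ, rrP, rrAl, rrBe, rrX]; ring
  · rw [rr_sum_1_2]; simp [Finset.sum_range_succ, rrP, rrAl, rrBe, rrX]; ring
  · rw [rr_sum_1_3]; simp [Finset.sum_range_succ, rrP, rrAl, rrBe, rrX]; ring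
  · rw [rr_sum_1_4]; simp [Finset.sum_range_succ, rrP, rrAl, rrBe, rrX]; ring

lemma rr_total_two (n : ℕ) :
    3 * ∑ i ∈ Finset.range n, rrF 2 (i + 1) (n - 1 - i + 1) =
      3 * (n + 1) * rrX (2 * (n + 1) % 5) + (n + 1) + 11 * (n + 1) ^ 3
        - 15 * (n + 1) ^ 2 * rrX (2 * (n + 1) % 5) := by
  rw [rr_range, mul_sub]
  obtain ⟨j, s, hs, h⟩ : ∃ j s, s < 5 ∧ n + 1 = 5 * j + s :=
    ⟨(n + 1) / 5, (n + 1) % 5, Nat.mod_lt _ (by norm_num), by omega⟩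
  have hn : (n : ℤ) = 5 * j + s - 1 := by omega
  have hm : (5 * j + s) % 5 = s := by omega
  have hm2 : 2 * (5 * j + s) % 5 = 2 * s % 5 := by omega
  rw [h, hm, hm2, hn, rr_step, mul_add]
  interval_cases s
  · rw [rr_sum_2_0]; simp [Finset.sum_range_succ, rrP, rrAl, rrBe, rrX]; ring
  · rw [rr_sum_2_1]; simp [Finset.sum_range_succ, rrP, rrAl, rrBe, rrX]; ring
  · rw [rr_sum_2_2]; simp [Finset.sum_range_succ, rrP, rrAl, rrBe, rrX]; ring
  · rw [rr_sum_2_3]; simp [Finset.sum_range_succ, rrP, rrAl, rrBe, rrX]; ring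
  · rw [rr_sum_2_4]; simp [Finset.sum_range_succ, rrP, rrAl, rrBe, rrX]; ring


/-! ### Summability -/

lemma rr_summ_geo (i : ℕ) {r : ℝ} (h0 : 0 ≤ r) (h1 : r < 1) :
    Summable fun n : ℕ => ((n : ℝ) + 1) ^ i * r ^ n := by
  rcases h0.eq_or_lt with rfl | h0
  · refine summable_of_ne_finset_zero (s := {0}) fun n hn => ?_
    have : n ≠ 0 := by simpa using hn
    simp [this]
  have h := (summable_nat_add_iff 1).mpr
    (summable_pow_mul_geometric_of_norm_lt_one i (r := r) (by rwa [Real.norm_of_nonneg h0.le]))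
  refine (h.mul_left r⁻¹).congr fun n => ?_
  push_cast
  rw [pow_succ]; field_simp

lemma rr_pow_le {r : ℝ} (h0 : 0 ≤ r) (h1 : r < 1) (a b : ℕ) :
    r ^ ((a + 1) * (b + 1)) ≤ r ^ a * r ^ b := by
  rw [← pow_add]
  exact pow_le_pow_of_le_one h0 h1.le (by nlinarith)

lemma rr_summ2 (i j : ℕ) {r : ℝ} (h0 : 0 ≤ r) (h1 : r < 1) :
    Summable fun p : ℕ × ℕ =>
      (((p.1 : ℝ) + 1) ^ i * r ^ p.1) * (((p.2 : ℝ) + 1) ^ j * r ^ p.2) :=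
  (rr_summ_geo i h0 h1).mul_of_nonneg (rr_summ_geo j h0 h1)
    (fun n => by positivity) (fun n => by positivity)

/-- Four-variable majorant. -/
lemma rr_summ4 {r : ℝ} (h0 : 0 ≤ r) (h1 : r < 1) :
    Summable fun p : (ℕ × ℕ) × (ℕ × ℕ) =>
      ((((p.1.1 : ℝ) + 1) ^ 4 * r ^ p.1.1) * (((p.1.2 : ℝ) + 1) ^ 4 * r ^ p.1.2)) *
      ((((p.2.1 : ℝ) + 1) ^ 0 * r ^ p.2.1) * (((p.2.2 : ℝ) + 1) ^ 0 * r ^ p.2.2)) :=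
  (rr_summ2 4 4 h0 h1).mul_of_nonneg (rr_summ2 0 0 h0 h1)
    (fun n => by positivity) (fun n => by positivity)

/-- General Lambert double series. -/
noncomputable def rrLam (c : ℕ → ℕ → ℂ) (q : ℂ) : ℂ :=
  ∑' p : ℕ × ℕ, c p.1 p.2 * q ^ ((p.1 + 1) * (p.2 + 1))

/-- Polynomial growth of coefficients. -/
def rrPB (c : ℕ → ℕ → ℂ) : Prop := ∃ K : ℝ, ∀ n k, ‖c n k‖ ≤ K * (((n : ℝ) + 1) ^ 5 * ((k : ℝ) + 1) ^ 5)

lemma rr_term_le {c : ℕ → ℕ → ℂ} {K : ℝ}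
    (hK : ∀ n k, ‖c n k‖ ≤ K * (((n : ℝ) + 1) ^ 5 * ((k : ℝ) + 1) ^ 5)) {q : ℂ} {r : ℝ}
    (hq : ‖q‖ ≤ r) (h1 : r < 1) (p : ℕ × ℕ) :
    ‖c p.1 p.2 * q ^ ((p.1 + 1) * (p.2 + 1))‖ ≤
      K * ((((p.1 : ℝ) + 1) ^ 5 * r ^ p.1) * (((p.2 : ℝ) + 1) ^ 5 * r ^ p.2)) := by
  have h0 : 0 ≤ r := (norm_nonneg q).trans hq
  rw [norm_mul, norm_pow]
  calc _ ≤ (K * (((p.1 : ℝ) + 1) ^ 5 * ((p.2 : ℝ) + 1) ^ 5)) * (r ^ p.1 * r ^ p.2) := by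
        refine mul_le_mul (hK _ _) ?_ (by positivity) ((norm_nonneg _).trans (hK p.1 p.2))
        exact (pow_le_pow_left₀ (norm_nonneg _) hq _).trans (rr_pow_le h0 h1 _ _)
    _ = _ := by ring

lemma rrLam_summable {c : ℕ → ℕ → ℂ} (hc : rrPB c) {q : ℂ} (hq : ‖q‖ < 1) :
    Summable fun p : ℕ × ℕ => c p.1 p.2 * q ^ ((p.1 + 1) * (p.2 + 1)) := by
  obtain ⟨K, hK⟩ := hc
  exact Summable.of_norm_bounded ((rr_summ2 5 5 (norm_nonneg q) hq).mul_left K)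
    fun p => rr_term_le hK le_rfl hq p

lemma rrLam_summable_norm {c : ℕ → ℕ → ℂ} (hc : rrPB c) {q : ℂ} (hq : ‖q‖ < 1) :
    Summable fun p : ℕ × ℕ => ‖c p.1 p.2 * q ^ ((p.1 + 1) * (p.2 + 1))‖ :=
  (rrLam_summable hc hq).norm

/-! ### The convolution identity -/

lemma rr_split (F : ℕ × ℕ → ℂ) (hF : Summable F) :
    ∑' p, F p = ∑' p : ℕ × ℕ, F (p.1 + p.2 + 1, p.2) + ∑' p : ℕ × ℕ, F (p.1, p.1 + p.2 + 1)
      + ∑' n, F (n, n) := by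
  let f : (ℕ × ℕ) ⊕ (ℕ × ℕ) ⊕ ℕ → ℕ × ℕ := Sum.elim (fun p => (p.1 + p.2 + 1, p.2))
    (Sum.elim (fun p => (p.1, p.1 + p.2 + 1)) fun n => (n, n))
  have hf : Function.Bijective f := by
    constructor
    · rintro (⟨a, b⟩ | ⟨a, b⟩ | a) (⟨c, d⟩ | ⟨c, d⟩ | c) h <;> simp [f] at h ⊢ <;> omega
    · rintro ⟨a, b⟩
      rcases lt_trichotomy a b with h | h | h
      · exact ⟨Sum.inr (Sum.inl (a, b - a - 1)), by simp [f]; omega⟩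
      · exact ⟨Sum.inr (Sum.inr a), by simp [f]; omega⟩
      · exact ⟨Sum.inl (a - b - 1, b), by simp [f]; omega⟩
  have hs : Summable (F ∘ f) := hF.comp_injective hf.1
  have e1 : ∑' x, (F ∘ f) x = ∑' p, F p := (Equiv.ofBijective f hf).tsum_eq F
  have h1 : Summable ((F ∘ f) ∘ Sum.inl) := hs.comp_injective Sum.inl_injective
  have h2 : Summable ((F ∘ f) ∘ Sum.inr) := hs.comp_injective Sum.inr_injective
  have h3 : Summable (((F ∘ f) ∘ Sum.inr) ∘ Sum.inl) := h2.comp_injective Sum.inl_injective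
  have h4 : Summable (((F ∘ f) ∘ Sum.inr) ∘ Sum.inr) := h2.comp_injective Sum.inr_injective
  have e2 := (h1.hasSum.sum (f := F ∘ f) (h3.hasSum.sum (f := (F ∘ f) ∘ Sum.inr) h4.hasSum)).tsum_eq
  rw [← e1, e2, ← add_assoc]
  rfl

lemma rr_splitE {E : Type} (G : E × (ℕ × ℕ) → ℂ) (hG : Summable G) :
    ∑' p, G p = ∑' p : E × (ℕ × ℕ), G (p.1, (p.2.1 + p.2.2 + 1, p.2.2))
      + ∑' p : E × (ℕ × ℕ), G (p.1, (p.2.1, p.2.1 + p.2.2 + 1))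
      + ∑' p : E × ℕ, G (p.1, (p.2, p.2)) := by
  have s1 : Summable fun p : E × (ℕ × ℕ) => G (p.1, (p.2.1 + p.2.2 + 1, p.2.2)) :=
    hG.comp_injective (i := fun p : E × (ℕ × ℕ) => (p.1, (p.2.1 + p.2.2 + 1, p.2.2)))
      (by rintro ⟨a, b, c⟩ ⟨a', b', c'⟩ h
          simp only [Prod.mk.injEq] at h ⊢
          exact ⟨h.1, by omega, by omega⟩)
  have s2 : Summable fun p : E × (ℕ × ℕ) => G (p.1, (p.2.1, p.2.1 + p.2.2 + 1)) :=
    hG.comp_injective (i := fun p : E × (ℕ × ℕ) => (p.1, (p.2.1, p.2.1 + p.2.2 + 1)))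
      (by rintro ⟨a, b, c⟩ ⟨a', b', c'⟩ h
          simp only [Prod.mk.injEq] at h ⊢
          exact ⟨h.1, by omega, by omega⟩)
  have s3 : Summable fun p : E × ℕ => G (p.1, (p.2, p.2)) :=
    hG.comp_injective (i := fun p : E × ℕ => (p.1, (p.2, p.2)))
      (by rintro ⟨a, b⟩ ⟨a', b'⟩ h
          simp only [Prod.mk.injEq] at h ⊢
          exact ⟨h.1, by omega⟩)
  rw [hG.tsum_prod, s1.tsum_prod, s2.tsum_prod, s3.tsum_prod,
    ← s1.prod.tsum_add s2.prod, ← (s1.prod.add s2.prod).tsum_add s3.prod]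
  exact tsum_congr fun e => rr_split (fun p => G (e, p)) (hG.prod_factor e)

section
variable (q : ℂ)

/-- Four-variable sum. -/
noncomputable def rrT (F : ℕ → ℕ → ℂ) : ℂ := ∑' p : (ℕ × ℕ) × (ℕ × ℕ),
  F p.1.1 p.1.2 * q ^ ((p.1.1 + 1) * (p.2.1 + 1) + (p.1.2 + 1) * (p.2.2 + 1))

/-- Shifted four-variable sum. -/
noncomputable def rrU (F : ℕ → ℕ → ℂ) : ℂ := ∑' p : (ℕ × ℕ) × (ℕ × ℕ),
  F p.1.1 p.1.2 * q ^ ((p.1.1 + 1) * (p.2.1 + p.2.2 + 2) + (p.1.2 + 1) * (p.2.2 + 1))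

end

/-- Growth condition for convolution weights. -/
def rrB2 (F : ℕ → ℕ → ℂ) : Prop := ∃ K : ℝ, ∀ a b, ‖F a b‖ ≤ K * (((a : ℝ) + 1) ^ 4 * ((b : ℝ) + 1) ^ 4)

lemma rr_summ_gen {F : ℕ → ℕ → ℂ} (hF : rrB2 F) {q : ℂ} (hq : ‖q‖ < 1)
    (e : (ℕ × ℕ) × (ℕ × ℕ) → ℕ) (he : ∀ p, p.1.1 + p.1.2 + p.2.1 + p.2.2 ≤ e p) :
    Summable fun p : (ℕ × ℕ) × (ℕ × ℕ) => F p.1.1 p.1.2 * q ^ e p := by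
  obtain ⟨K, hK⟩ := hF
  refine Summable.of_norm_bounded ((rr_summ4 (norm_nonneg q) hq).mul_left K) fun p => ?_
  rw [norm_mul, norm_pow]
  calc _ ≤ (K * (((p.1.1 : ℝ) + 1) ^ 4 * ((p.1.2 : ℝ) + 1) ^ 4)) *
        ‖q‖ ^ (p.1.1 + p.1.2 + p.2.1 + p.2.2) := by
        refine mul_le_mul (hK _ _) ?_ (by positivity) ((norm_nonneg _).trans (hK p.1.1 p.1.2))
        exact pow_le_pow_of_le_one (norm_nonneg q) hq.le (he p)
    _ = _ := by rw [pow_add, pow_add, pow_add]; ring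

lemma rrT_summable {F : ℕ → ℕ → ℂ} (hF : rrB2 F) {q : ℂ} (hq : ‖q‖ < 1) :
    Summable fun p : (ℕ × ℕ) × (ℕ × ℕ) =>
      F p.1.1 p.1.2 * q ^ ((p.1.1 + 1) * (p.2.1 + 1) + (p.1.2 + 1) * (p.2.2 + 1)) :=
  rr_summ_gen hF hq _ fun p => by nlinarith

lemma rrU_summable {F : ℕ → ℕ → ℂ} (hF : rrB2 F) {q : ℂ} (hq : ‖q‖ < 1) :
    Summable fun p : (ℕ × ℕ) × (ℕ × ℕ) =>
      F p.1.1 p.1.2 * q ^ ((p.1.1 + 1) * (p.2.1 + p.2.2 + 2) + (p.1.2 + 1) * (p.2.2 + 1)) :=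
  rr_summ_gen hF hq _ fun p => by nlinarith

/-- Swap both pairs. -/
def rrSwap : (ℕ × ℕ) × (ℕ × ℕ) ≃ (ℕ × ℕ) × (ℕ × ℕ) :=
  Equiv.prodCongr (Equiv.prodComm ℕ ℕ) (Equiv.prodComm ℕ ℕ)

lemma rrT_splitX {F : ℕ → ℕ → ℂ} (hF : rrB2 F) (hs : ∀ a b, F a b = F b a) {q : ℂ}
    (hq : ‖q‖ < 1) :
    rrT q F = 2 * rrU q F + ∑' p : (ℕ × ℕ) × ℕ,
      F p.1.1 p.1.2 * q ^ ((p.1.1 + p.1.2 + 2) * (p.2 + 1)) := by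
  rw [rrT, rr_splitE _ (rrT_summable hF hq), two_mul]
  refine congrArg₂ (· + ·) (congrArg₂ (· + ·) ?_ ?_) ?_
  · · refine tsum_congr fun ⟨⟨a, b⟩, x, y⟩ => ?_
      show F a b * q ^ ((a + 1) * (x + y + 1 + 1) + (b + 1) * (y + 1)) =
        F a b * q ^ ((a + 1) * (x + y + 2) + (b + 1) * (y + 1))
      ring_nf
  · · refine (rrSwap.tsum_eq _).symm.trans (tsum_congr fun ⟨⟨a, b⟩, x, y⟩ => ?_)
      show F b a * q ^ ((b + 1) * (y + 1) + (a + 1) * (y + x + 1 + 1)) =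
        F a b * q ^ ((a + 1) * (x + y + 2) + (b + 1) * (y + 1))
      rw [hs]
      ring_nf
  · refine tsum_congr fun ⟨⟨a, b⟩, x⟩ => ?_
    show F a b * q ^ ((a + 1) * (x + 1) + (b + 1) * (x + 1)) =
      F a b * q ^ ((a + b + 2) * (x + 1))
    ring_nf

/-- Exchange the two pairs. -/
def rrExch : (ℕ × ℕ) × (ℕ × ℕ) ≃ (ℕ × ℕ) × (ℕ × ℕ) := Equiv.prodComm _ _

lemma rrT_splitA {F : ℕ → ℕ → ℂ} (hF : rrB2 F) (hs : ∀ a b, F a b = F b a) {q : ℂ}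
    (hq : ‖q‖ < 1) :
    rrT q F = 2 * rrU q (fun a b => F a (a + b + 1)) + ∑' p : (ℕ × ℕ) × ℕ,
      F p.2 p.2 * q ^ ((p.1.1 + p.1.2 + 2) * (p.2 + 1)) := by
  have hsum : Summable fun p : (ℕ × ℕ) × (ℕ × ℕ) =>
      F p.2.1 p.2.2 * q ^ ((p.2.1 + 1) * (p.1.1 + 1) + (p.2.2 + 1) * (p.1.2 + 1)) :=
    (rrExch.summable_iff.mpr (rrT_summable hF hq)).congr fun p => by
      simp [rrExch]
  have h0 : rrT q F = ∑' p : (ℕ × ℕ) × (ℕ × ℕ),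
      F p.2.1 p.2.2 * q ^ ((p.2.1 + 1) * (p.1.1 + 1) + (p.2.2 + 1) * (p.1.2 + 1)) := by
    rw [rrT, ← rrExch.tsum_eq]
    refine tsum_congr fun p => ?_
    simp [rrExch]
  rw [h0, rr_splitE _ hsum, two_mul]
  refine congrArg₂ (· + ·) (congrArg₂ (· + ·) ?_ ?_) ?_
  · · refine ((rrExch.trans rrSwap).tsum_eq _).symm.trans (tsum_congr fun ⟨⟨a, b⟩, x, y⟩ => ?_)
      show F (b + a + 1) a * q ^ ((b + a + 1 + 1) * (y + 1) + (a + 1) * (x + 1)) =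
        F a (a + b + 1) * q ^ ((a + 1) * (x + y + 2) + (b + 1) * (y + 1))
      rw [hs, add_comm b a]
      ring_nf
  · · refine (rrExch.tsum_eq _).symm.trans (tsum_congr fun ⟨⟨a, b⟩, x, y⟩ => ?_)
      show F a (a + b + 1) * q ^ ((a + 1) * (x + 1) + (a + b + 1 + 1) * (y + 1)) =
        F a (a + b + 1) * q ^ ((a + 1) * (x + y + 2) + (b + 1) * (y + 1))
      ring_nf
  · refine tsum_congr fun ⟨⟨x, y⟩, a⟩ => ?_
    show F a a * q ^ ((a + 1) * (x + 1) + (a + 1) * (y + 1)) =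
      F a a * q ^ ((x + y + 2) * (a + 1))
    ring_nf

lemma rr_key {F H : ℕ → ℕ → ℂ} (hF : rrB2 F) (hH : rrB2 H) (hFs : ∀ a b, F a b = F b a)
    (hHs : ∀ a b, H a b = H b a) (hrel : ∀ a b, F a (a + b + 1) - F a b = H a (a + b + 1))
    (hF' : rrB2 fun a b => F a (a + b + 1))
    {q : ℂ} (hq : ‖q‖ < 1) :
    rrT q H + ∑' p : (ℕ × ℕ) × ℕ, F p.2 p.2 * q ^ ((p.1.1 + p.1.2 + 2) * (p.2 + 1)) =
      ∑' p : (ℕ × ℕ) × ℕ, F p.1.1 p.1.2 * q ^ ((p.1.1 + p.1.2 + 2) * (p.2 + 1)) +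
      ∑' p : (ℕ × ℕ) × ℕ, H p.2 p.2 * q ^ ((p.1.1 + p.1.2 + 2) * (p.2 + 1)) := by
  have h1 := rrT_splitX hF hFs hq
  have h2 := rrT_splitA hF hFs hq
  have h3 := rrT_splitA hH hHs hq
  have h4 : rrU q (fun a b => H a (a + b + 1)) = rrU q (fun a b => F a (a + b + 1)) - rrU q F := by
    rw [rrU, rrU, rrU, ← (rrU_summable hF' hq).tsum_sub (rrU_summable hF hq)]
    refine tsum_congr fun p => ?_
    rw [← hrel]; ring
  rw [h4] at h3
  linear_combination h3 + h1 - h2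

lemma rr_antidiag (F : ℕ → ℕ → ℕ → ℂ) {q : ℂ} (hq : ‖q‖ < 1)
    (hs : Summable fun p : (ℕ × ℕ) × ℕ =>
      F p.1.1 p.1.2 p.2 * q ^ ((p.1.1 + p.1.2 + 2) * (p.2 + 1)))
    (c : ℕ → ℕ → ℂ) (hc : rrPB c) (hcF : ∀ n x, ∑ i ∈ Finset.range n, F i (n - 1 - i) x = c n x) :
    ∑' p : (ℕ × ℕ) × ℕ, F p.1.1 p.1.2 p.2 * q ^ ((p.1.1 + p.1.2 + 2) * (p.2 + 1)) =
      rrLam c q := by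
  have hl := rrLam_summable hc hq
  have hl' : Summable fun p : ℕ × ℕ => c p.2 p.1 * q ^ ((p.2 + 1) * (p.1 + 1)) :=
    ((Equiv.prodComm ℕ ℕ).summable_iff.mpr hl).congr fun p => by simp
  have hs' : Summable fun p : ℕ × (ℕ × ℕ) =>
      F p.2.1 p.2.2 p.1 * q ^ ((p.2.1 + p.2.2 + 2) * (p.1 + 1)) :=
    ((Equiv.prodComm ℕ (ℕ × ℕ)).summable_iff.mpr hs).congr fun p => by simp
  have e1 : rrLam c q = ∑' p : ℕ × ℕ, c p.2 p.1 * q ^ ((p.2 + 1) * (p.1 + 1)) := by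
    rw [rrLam, ← (Equiv.prodComm ℕ ℕ).tsum_eq]
    exact tsum_congr fun p => by simp
  have e2 : ∑' p : (ℕ × ℕ) × ℕ, F p.1.1 p.1.2 p.2 * q ^ ((p.1.1 + p.1.2 + 2) * (p.2 + 1)) =
      ∑' p : ℕ × (ℕ × ℕ), F p.2.1 p.2.2 p.1 * q ^ ((p.2.1 + p.2.2 + 2) * (p.1 + 1)) := by
    rw [← (Equiv.prodComm ℕ (ℕ × ℕ)).tsum_eq]
    exact tsum_congr fun p => by simp
  rw [e1, e2, hl'.tsum_prod, hs'.tsum_prod]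
  refine tsum_congr fun x => ?_
  have hx := hs'.prod_factor x
  have hx' := hl'.prod_factor x
  dsimp only at hx hx'
  rw [hx'.tsum_eq_zero_add]
  have h0 : c 0 x = 0 := by rw [← hcF]; simp
  rw [h0, zero_mul, zero_add]
  have hx2 := Finset.HasAntidiagonal.sigmaAntidiagonalEquivProd.summable_iff.mpr hx
  have e3 := Finset.HasAntidiagonal.sigmaAntidiagonalEquivProd.tsum_eq
    (fun p : ℕ × ℕ => F p.1 p.2 x * q ^ ((p.1 + p.2 + 2) * (x + 1)))
  refine (e3.symm.trans (Summable.tsum_sigma' (fun n => Summable.of_finite) hx2)).trans ?_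
  refine tsum_congr fun n => ?_
  have e4 : ∑ i ∈ Finset.range (n + 1), F i (n + 1 - 1 - i) x =
      ∑ p ∈ Finset.HasAntidiagonal.antidiagonal n, F p.1 p.2 x := by
    rw [Finset.Nat.sum_antidiagonal_eq_sum_range_succ_mk]; rfl
  rw [tsum_fintype, ← hcF, e4, Finset.sum_mul]
  rw [← Finset.sum_coe_sort (Finset.HasAntidiagonal.antidiagonal n)
    (fun p : ℕ × ℕ => F p.1 p.2 x * q ^ ((n + 1 + 1) * (x + 1)))]
  refine Finset.sum_congr rfl fun p _ => ?_
  have hp : p.1.1 + p.1.2 = n := Finset.HasAntidiagonal.mem_antidiagonal.mp p.2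
  simp [hp]

lemma rrPB_mono (u : ℕ → ℕ → ℂ) (hu : ∀ n k, ‖u n k‖ ≤ 1) (i j : ℕ) (hi : i ≤ 5) (hj : j ≤ 5) :
    rrPB fun n k => u n k * (((n : ℂ) + 1) ^ i * ((k : ℂ) + 1) ^ j) := by
  refine ⟨1, fun n k => ?_⟩
  have e1 : ‖((n : ℂ) + 1)‖ = (n : ℝ) + 1 := by exact_mod_cast Complex.norm_natCast (n + 1)
  have e2 : ‖((k : ℂ) + 1)‖ = (k : ℝ) + 1 := by exact_mod_cast Complex.norm_natCast (k + 1)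
  rw [norm_mul, norm_mul, norm_pow, norm_pow, e1, e2]
  have h1 : ((n : ℝ) + 1) ^ i ≤ ((n : ℝ) + 1) ^ 5 := pow_le_pow_right₀ (by simp) hi
  have h2 : ((k : ℝ) + 1) ^ j ≤ ((k : ℝ) + 1) ^ 5 := pow_le_pow_right₀ (by simp) hj
  have := hu n k
  gcongr

lemma rrPB_lin {c d : ℕ → ℕ → ℂ} (hc : rrPB c) (hd : rrPB d) (α β : ℂ) :
    rrPB fun n k => α * c n k + β * d n k := by
  obtain ⟨K, hK⟩ := hc
  obtain ⟨L, hL⟩ := hd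
  refine ⟨‖α‖ * K + ‖β‖ * L, fun n k => (norm_add_le _ _).trans ?_⟩
  rw [norm_mul, norm_mul, add_mul, mul_assoc, mul_assoc]
  gcongr
  · exact hK n k
  · exact hL n k

lemma rrLam_lin {c d : ℕ → ℕ → ℂ} (hc : rrPB c) (hd : rrPB d) (α β : ℂ) {q : ℂ} (hq : ‖q‖ < 1) :
    rrLam (fun n k => α * c n k + β * d n k) q = α * rrLam c q + β * rrLam d q := by
  rw [rrLam, rrLam, rrLam, ← tsum_mul_left, ← tsum_mul_left,
    ← ((rrLam_summable hc hq).mul_left α).tsum_add ((rrLam_summable hd hq).mul_left β)]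
  exact tsum_congr fun p => by ring

lemma rrLam_swap (c : ℕ → ℕ → ℂ) (q : ℂ) : rrLam (fun n k => c k n) q = rrLam c q := by
  rw [rrLam, rrLam, ← (Equiv.prodComm ℕ ℕ).tsum_eq]
  refine tsum_congr fun p => ?_
  simp [mul_comm]

/-- The indicator as a complex number (index shifted by one). -/
def rrC (t n : ℕ) : ℂ := (rrX (t * (n + 1) % 5) : ℂ)

lemma rrX_le (r : ℕ) : ‖(rrX r : ℂ)‖ ≤ 1 := by
  unfold rrX; split_ifs <;> simp

/-- Coefficients of `Σ χ(n)^e n^i k^j q^{nk}`. -/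
def rrM (u : ℕ → ℂ) (i j : ℕ) (n k : ℕ) : ℂ := u n * (((n : ℂ) + 1) ^ i * ((k : ℂ) + 1) ^ j)

lemma rrM_PB (u : ℕ → ℂ) (hu : ∀ n, ‖u n‖ ≤ 1) (i j : ℕ) (hi : i ≤ 5) (hj : j ≤ 5) :
    rrPB (rrM u i j) := rrPB_mono (fun n _ => u n) (fun n _ => hu n) i j hi hj

lemma rr_cast_norm (z : ℤ) : ‖(z : ℂ)‖ = ((|z| : ℤ) : ℝ) := by
  rw [Complex.norm_intCast]; simp

lemma rrB2_of (F : ℕ → ℕ → ℤ) (K : ℤ)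
    (h : ∀ a b : ℕ, |F a b| ≤ K * (((a : ℤ) + 1) ^ 4 * ((b : ℤ) + 1) ^ 4)) (m : ℂ) :
    rrB2 fun a b => m * (F a b : ℂ) := by
  refine ⟨‖m‖ * K, fun a b => ?_⟩
  rw [norm_mul, rr_cast_norm, mul_assoc]
  gcongr
  exact_mod_cast h a b

lemma rr_up {z K : ℤ} (hK : 0 ≤ K) {a b : ℕ} (h : z ≤ K * (((a : ℤ) + 1) ^ 2 * ((b : ℤ) + 1) ^ 2)) :
    z ≤ K * (((a : ℤ) + 1) ^ 4 * ((b : ℤ) + 1) ^ 4) := by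
  refine h.trans ?_
  have h1 : ((a : ℤ) + 1) ^ 2 ≤ ((a : ℤ) + 1) ^ 4 := pow_le_pow_right₀ (by omega) (by norm_num)
  have h2 : ((b : ℤ) + 1) ^ 2 ≤ ((b : ℤ) + 1) ^ 4 := pow_le_pow_right₀ (by omega) (by norm_num)
  gcongr

lemma rrF_bound (t a b : ℕ) :
    |rrF t (a + 1) (b + 1)| ≤ 30 * (((a : ℤ) + 1) ^ 2 * ((b : ℤ) + 1) ^ 2) := by
  have := rrP_bound (t * (a + 1) % 5) (t * (b + 1) % 5) (Nat.mod_lt _ (by norm_num))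
    (Nat.mod_lt _ (by norm_num)) (a + 1) (b + 1) (by omega) (by omega)
  simpa [rrF] using this

/-- The convolution weight. -/
def rrH (t a b : ℕ) : ℤ := (a * b) * rrW (t * a % 5) (t * b % 5)

lemma rrH_bound (t a b : ℕ) :
    |rrH t (a + 1) (b + 1)| ≤ 5 * (((a : ℤ) + 1) ^ 2 * ((b : ℤ) + 1) ^ 2) := by
  have h1 : |rrW (t * (a + 1) % 5) (t * (b + 1) % 5)| ≤ 5 := by
    unfold rrW rrX; split_ifs <;> simp
  have h2 : ((a : ℤ) + 1) * (b + 1) ≤ ((a : ℤ) + 1) ^ 2 * ((b : ℤ) + 1) ^ 2 := by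
    rw [← mul_pow]
    have : 1 ≤ ((a : ℤ) + 1) * (b + 1) := by nlinarith [mul_nonneg (Int.natCast_nonneg a) (Int.natCast_nonneg b)]
    nlinarith
  have h3 : 0 ≤ ((a : ℤ) + 1) * (b + 1) := by positivity
  rw [rrH, abs_mul]
  push_cast
  rw [abs_of_nonneg h3]
  nlinarith [abs_nonneg (rrW (t * (a + 1) % 5) (t * (b + 1) % 5))]

lemma rrF_sym (t a b : ℕ) : rrF t a b = rrF t b a :=
  rrP_sym _ _ (Nat.mod_lt _ (by norm_num)) (Nat.mod_lt _ (by norm_num)) _ _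

lemma rrH_sym (t a b : ℕ) : rrH t a b = rrH t b a := by
  unfold rrH rrW; ring

lemma rrF_rel (t a b : ℕ) : rrF t a (a + b) - rrF t a b = 5 * rrH t a (a + b) := by
  have := rrP_rel (t * a % 5) (t * b % 5) (Nat.mod_lt _ (by norm_num)) (Nat.mod_lt _ (by norm_num))
    a b
  rw [show (t * a % 5 + t * b % 5) % 5 = t * (a + b) % 5 by rw [mul_add, ← Nat.add_mod]] at this
  simpa [rrF, rrH] using this

/-- Regroup the four variables. -/
def rrMix : (ℕ × ℕ) × (ℕ × ℕ) ≃ (ℕ × ℕ) × (ℕ × ℕ) := Equiv.prodProdProdComm _ _ _ _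

lemma rr_prod {u v : ℕ → ℂ} (hu : ∀ n, ‖u n‖ ≤ 1) (hv : ∀ n, ‖v n‖ ≤ 1) {q : ℂ} (hq : ‖q‖ < 1) :
    HasSum (fun p : (ℕ × ℕ) × (ℕ × ℕ) => (u p.1.1 * v p.1.2 * (((p.1.1 : ℂ) + 1) * (p.1.2 + 1))) *
      q ^ ((p.1.1 + 1) * (p.2.1 + 1) + (p.1.2 + 1) * (p.2.2 + 1)))
      (rrLam (rrM u 1 0) q * rrLam (rrM v 1 0) q) := by
  have sX := rrLam_summable_norm (rrM_PB u hu 1 0 (by norm_num) (by norm_num)) hq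
  have sS := rrLam_summable_norm (rrM_PB v hv 1 0 (by norm_num) (by norm_num)) hq
  have h := (summable_mul_of_summable_norm sX sS).hasSum
  rw [← tsum_mul_tsum_of_summable_norm sX sS] at h
  have h2 := rrMix.hasSum_iff.mpr h
  refine Eq.mp (congrArg (fun f => HasSum f _) (funext fun p => ?_)) h2
  simp only [rrMix, rrM, Function.comp_apply, Equiv.prodProdProdComm_apply, pow_add]
  ring

lemma rr_conv (t : ℕ) {q : ℂ} (hq : ‖q‖ < 1) :
    rrT q (fun a b => (rrH t (a + 1) (b + 1) : ℂ)) =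
      4 * (rrLam (rrM (rrC t) 1 0) q * rrLam (rrM (fun _ => 1) 1 0) q)
        + rrLam (rrM (rrC t) 1 0) q * rrLam (rrM (rrC t) 1 0) q := by
  have hX : ∀ n, ‖rrC t n‖ ≤ 1 := fun n => rrX_le _
  have hS : ∀ n : ℕ, ‖(fun _ => 1 : ℕ → ℂ) n‖ ≤ 1 := fun n => by simp
  have h := (((rr_prod hX hS hq).mul_left 2).add ((rr_prod hS hX hq).mul_left 2)).add
    (rr_prod hX hX hq)
  refine Eq.trans (Eq.trans ?_ h.tsum_eq) (by ring)
  refine tsum_congr fun p => ?_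
  simp only [rrH, rrW, rrC]
  push_cast
  ring

lemma rr_main (t : ℕ) {q : ℂ} (hq : ‖q‖ < 1) (g : ℕ → ℂ) (hg : rrPB fun n _ => g n)
    (hgF : ∀ n, ∑ i ∈ Finset.range n, 5⁻¹ * (rrF t (i + 1) (n - 1 - i + 1) : ℂ) = g n) :
    4 * (rrLam (rrM (rrC t) 1 0) q * rrLam (rrM (fun _ => 1) 1 0) q)
        + rrLam (rrM (rrC t) 1 0) q * rrLam (rrM (rrC t) 1 0) q
      + rrLam (rrM (rrC t) 2 1) q = rrLam (fun n _ => g n) q + rrLam (rrM (rrC t) 2 0) q := by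
  have bF := rrB2_of _ 30 (fun a b => rr_up (by norm_num) (rrF_bound t a b)) 5⁻¹
  have bH : rrB2 fun a b => (rrH t (a + 1) (b + 1) : ℂ) := by
    simpa using rrB2_of _ 5 (fun a b => rr_up (by norm_num) (rrH_bound t a b)) 1
  have hrel : ∀ a b : ℕ, (5⁻¹ * (rrF t (a + 1) (a + b + 1 + 1) : ℂ)) -
      5⁻¹ * (rrF t (a + 1) (b + 1) : ℂ) = (rrH t (a + 1) (a + b + 1 + 1) : ℂ) := by
    intro a b
    have := rrF_rel t (a + 1) (b + 1)
    rw [show a + 1 + (b + 1) = a + b + 1 + 1 by ring] at this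
    have : ((rrF t (a + 1) (a + b + 1 + 1) : ℂ)) - rrF t (a + 1) (b + 1) =
      5 * rrH t (a + 1) (a + b + 1 + 1) := by exact_mod_cast this
    linear_combination this / 5
  have bF' : rrB2 fun a b => 5⁻¹ * (rrF t (a + 1) (a + b + 1 + 1) : ℂ) := by
    refine rrB2_of (fun a b => rrF t (a + 1) (a + b + 1 + 1)) 120 (fun a b => ?_) 5⁻¹
    refine (rrF_bound t a (a + b + 1)).trans ?_
    push_cast
    have h1 : (a : ℤ) + b + 1 + 1 ≤ 2 * ((a + 1) * (b + 1)) := by nlinarith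
    have h2 : ((a : ℤ) + b + 1 + 1) ^ 2 ≤ (2 * ((a + 1) * (b + 1))) ^ 2 :=
      pow_le_pow_left₀ (by positivity) h1 2
    have h3 : ((b : ℤ) + 1) ^ 2 ≤ ((b : ℤ) + 1) ^ 4 := pow_le_pow_right₀ (by omega) (by norm_num)
    calc 30 * (((a : ℤ) + 1) ^ 2 * ((a : ℤ) + b + 1 + 1) ^ 2)
        ≤ 30 * (((a : ℤ) + 1) ^ 2 * (2 * ((a + 1) * (b + 1))) ^ 2) := by gcongr
      _ = 120 * (((a : ℤ) + 1) ^ 4 * ((b : ℤ) + 1) ^ 2) := by ring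
      _ ≤ _ := by gcongr
  have key := rr_key (F := fun a b => 5⁻¹ * (rrF t (a + 1) (b + 1) : ℂ)) bF bH
    (fun a b => by rw [rrF_sym]) (fun a b => by rw [rrH_sym]) hrel bF' hq
  have s1 : Summable fun p : (ℕ × ℕ) × ℕ => 5⁻¹ * (rrF t (p.1.1 + 1) (p.1.2 + 1) : ℂ) *
      q ^ ((p.1.1 + p.1.2 + 2) * (p.2 + 1)) := by
    refine ((rrT_summable bF hq).comp_injective
      (i := fun p : (ℕ × ℕ) × ℕ => (p.1, (p.2, p.2))) ?_).congr fun p => ?_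
    · rintro ⟨a, b⟩ ⟨a', b'⟩ h
      simp only [Prod.mk.injEq] at h ⊢
      exact ⟨h.1, h.2.1⟩
    · simp only [Function.comp_apply]; ring_nf
  have diag : ∀ {G : ℕ → ℕ → ℂ}, rrB2 G → Summable fun p : (ℕ × ℕ) × ℕ => G p.2 p.2 *
      q ^ ((p.1.1 + p.1.2 + 2) * (p.2 + 1)) := by
    intro G hG
    refine ((rrT_summable hG hq).comp_injective
      (i := fun p : (ℕ × ℕ) × ℕ => ((p.2, p.2), p.1)) ?_).congr fun p => ?_
    · rintro ⟨a, b⟩ ⟨a', b'⟩ h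
      simp only [Prod.mk.injEq] at h ⊢
      exact ⟨h.2, h.1.1⟩
    · simp only [Function.comp_apply]; ring_nf
  have s2 := diag bF
  have s3 := diag bH
  have hc := rrM_PB (rrC t) (fun n => rrX_le _)
  have bd := rrPB_lin (hc 2 0 (by norm_num) (by norm_num)) (hc 2 1 (by norm_num) (by norm_num)) 1 (-1)
  have bd' : rrPB fun n k => 1 * rrM (rrC t) 2 0 k n + (-1) * rrM (rrC t) 2 1 k n := by
    obtain ⟨K, hK⟩ := bd
    exact ⟨K, fun n k => by rw [mul_comm (((n : ℝ) + 1) ^ 5)]; exact hK k n⟩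
  have A1 := rr_antidiag (fun a b _ => 5⁻¹ * (rrF t (a + 1) (b + 1) : ℂ)) hq s1
    (fun n _ => g n) hg (fun n x => hgF n)
  have A2 := rr_antidiag (fun _ _ x => (rrH t (x + 1) (x + 1) : ℂ) -
      5⁻¹ * (rrF t (x + 1) (x + 1) : ℂ)) hq ((s3.sub s2).congr fun p => by ring) _ bd' (by
    intro n x
    have := rrP_diag (t * (x + 1) % 5) (Nat.mod_lt _ (by norm_num)) ((x + 1 : ℕ) : ℤ)
    have h2 : 5 * rrH t (x + 1) (x + 1) - rrF t (x + 1) (x + 1) =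
      -5 * (((x : ℤ) + 1) ^ 2 * rrX (t * (x + 1) % 5)) := by
      simpa [rrH, rrF] using this
    have h3 : 5 * (rrH t (x + 1) (x + 1) : ℂ) - rrF t (x + 1) (x + 1) =
      -5 * (((x : ℂ) + 1) ^ 2 * rrX (t * (x + 1) % 5)) := by exact_mod_cast h2
    rw [Finset.sum_const, Finset.card_range, nsmul_eq_mul, rrM, rrM, rrC]
    linear_combination (n : ℂ) / 5 * h3)
  have A3 : ∑' p : (ℕ × ℕ) × ℕ, ((rrH t (p.2 + 1) (p.2 + 1) : ℂ) -
      5⁻¹ * (rrF t (p.2 + 1) (p.2 + 1) : ℂ)) * q ^ ((p.1.1 + p.1.2 + 2) * (p.2 + 1)) =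
      ∑' p : (ℕ × ℕ) × ℕ, (rrH t (p.2 + 1) (p.2 + 1) : ℂ) * q ^ ((p.1.1 + p.1.2 + 2) * (p.2 + 1)) -
      ∑' p : (ℕ × ℕ) × ℕ, 5⁻¹ * (rrF t (p.2 + 1) (p.2 + 1) : ℂ) *
        q ^ ((p.1.1 + p.1.2 + 2) * (p.2 + 1)) := by
    rw [← s3.tsum_sub s2]
    exact tsum_congr fun p => by ring
  rw [rrLam_swap (fun n k => 1 * rrM (rrC t) 2 0 n k + (-1) * rrM (rrC t) 2 1 n k),
    rrLam_lin (hc 2 0 (by norm_num) (by norm_num)) (hc 2 1 (by norm_num) (by norm_num)) _ _ hq] at A2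
  rw [rr_conv t hq] at key
  linear_combination key + A1 + A2 - A3

/-! ### Riccati identities -/

lemma rr_ric_one {q : ℂ} (hq : ‖q‖ < 1) :
    rrLam (rrM (rrC 1) 2 1) q + rrLam (rrM (rrC 1) 1 0) q * rrLam (rrM (rrC 1) 1 0) q
      + 4 * (rrLam (rrM (rrC 1) 1 0) q * rrLam (rrM (fun _ => 1) 1 0) q)
      + 1 / 5 * rrLam (rrM (rrC 1) 1 0) q
      + 11 / 15 * (rrLam (rrM (fun _ => 1) 1 0) q - rrLam (rrM (fun _ => 1) 3 0) q) = 0 := by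
  have hc := rrM_PB (rrC 1) (fun n => rrX_le _)
  have hd := rrM_PB (fun _ => 1) (fun n => by simp)
  have c1 := hc 1 0 (by norm_num) (by norm_num)
  have c2 := hc 2 0 (by norm_num) (by norm_num)
  have d1 := hd 1 0 (by norm_num) (by norm_num)
  have d3 := hd 3 0 (by norm_num) (by norm_num)
  have b1 := rrPB_lin c1 c2 (-(1 / 5)) (-1)
  have b2 := rrPB_lin d1 d3 (-(11 / 15)) (11 / 15)
  have e := rrLam_lin b1 b2 1 1 hq
  have b := rrPB_lin b1 b2 1 1
  rw [rrLam_lin c1 c2 _ _ hq, rrLam_lin d1 d3 _ _ hq] at e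
  have hg : (fun n k : ℕ => 1 * (-(1 / 5) * rrM (rrC 1) 1 0 n k + -1 * rrM (rrC 1) 2 0 n k) +
      1 * (-(11 / 15) * rrM (fun _ => 1) 1 0 n k + 11 / 15 * rrM (fun _ => 1) 3 0 n k)) =
      (fun n _ => -(1 / 5) * (rrC 1 n * ((n : ℂ) + 1)) - rrC 1 n * ((n : ℂ) + 1) ^ 2
        - 11 / 15 * ((n : ℂ) + 1) + 11 / 15 * ((n : ℂ) + 1) ^ 3) := by
    funext n k
    simp only [rrM]
    ring
  rw [hg] at e b
  have := rr_main 1 hq _ b (fun n => by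
    have h : 3 * ∑ i ∈ Finset.range n, (rrF 1 (i + 1) (n - 1 - i + 1) : ℂ) =
      -3 * (n + 1) * rrX (1 * (n + 1) % 5) - 11 * ((n + 1) - (n + 1) ^ 3)
        - 15 * (n + 1) ^ 2 * rrX (1 * (n + 1) % 5) := by exact_mod_cast rr_total_one n
    rw [← Finset.mul_sum, rrC]
    linear_combination h / 15)
  linear_combination this + e

lemma rr_ric_two {q : ℂ} (hq : ‖q‖ < 1) :
    rrLam (rrM (rrC 2) 2 1) q + rrLam (rrM (rrC 2) 1 0) q * rrLam (rrM (rrC 2) 1 0) q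
      + 4 * (rrLam (rrM (rrC 2) 1 0) q * rrLam (rrM (fun _ => 1) 1 0) q)
      - 1 / 5 * rrLam (rrM (rrC 2) 1 0) q
      - 1 / 15 * rrLam (rrM (fun _ => 1) 1 0) q
      - 11 / 15 * rrLam (rrM (fun _ => 1) 3 0) q = 0 := by
  have hc := rrM_PB (rrC 2) (fun n => rrX_le _)
  have hd := rrM_PB (fun _ => 1) (fun n => by simp)
  have c1 := hc 1 0 (by norm_num) (by norm_num)
  have c2 := hc 2 0 (by norm_num) (by norm_num)
  have d1 := hd 1 0 (by norm_num) (by norm_num)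
  have d3 := hd 3 0 (by norm_num) (by norm_num)
  have b1 := rrPB_lin c1 c2 (1 / 5) (-1)
  have b2 := rrPB_lin d1 d3 (1 / 15) (11 / 15)
  have e := rrLam_lin b1 b2 1 1 hq
  have b := rrPB_lin b1 b2 1 1
  rw [rrLam_lin c1 c2 _ _ hq, rrLam_lin d1 d3 _ _ hq] at e
  have hg : (fun n k : ℕ => 1 * (1 / 5 * rrM (rrC 2) 1 0 n k + -1 * rrM (rrC 2) 2 0 n k) +
      1 * (1 / 15 * rrM (fun _ => 1) 1 0 n k + 11 / 15 * rrM (fun _ => 1) 3 0 n k)) =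
      (fun n _ => 1 / 5 * (rrC 2 n * ((n : ℂ) + 1)) - rrC 2 n * ((n : ℂ) + 1) ^ 2
        + 1 / 15 * ((n : ℂ) + 1) + 11 / 15 * ((n : ℂ) + 1) ^ 3) := by
    funext n k
    simp only [rrM]
    ring
  rw [hg] at e b
  have := rr_main 2 hq _ b (fun n => by
    have h : 3 * ∑ i ∈ Finset.range n, (rrF 2 (i + 1) (n - 1 - i + 1) : ℂ) =
      3 * (n + 1) * rrX (2 * (n + 1) % 5) + (n + 1) + 11 * (n + 1) ^ 3
        - 15 * (n + 1) ^ 2 * rrX (2 * (n + 1) % 5) := by exact_mod_cast rr_total_two n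
    rw [← Finset.mul_sum, rrC]
    linear_combination h / 15)
  linear_combination this + e

/-! ### Analytic part -/

lemma rrLam_deriv {c : ℕ → ℕ → ℂ} (hc : rrPB c) {q : ℂ} (hq : ‖q‖ < 1) :
    ∃ d, HasDerivAt (rrLam c) d q ∧
      q * d = rrLam (fun n k => ((n : ℂ) + 1) * (k + 1) * c n k) q := by
  obtain ⟨K, hK⟩ := hc
  obtain ⟨r, hr, hr1⟩ := exists_between hq
  have hU : IsOpen (Metric.ball (0 : ℂ) r) := Metric.isOpen_ball
  have hz : q ∈ Metric.ball (0 : ℂ) r := by simpa using hr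
  have hu := (rr_summ2 5 5 ((norm_nonneg q).trans hr.le) hr1).mul_left K
  have hle : ∀ (p : ℕ × ℕ) (w : ℂ), w ∈ Metric.ball (0 : ℂ) r →
      ‖c p.1 p.2 * w ^ ((p.1 + 1) * (p.2 + 1))‖ ≤
      K * ((((p.1 : ℝ) + 1) ^ 5 * r ^ p.1) * (((p.2 : ℝ) + 1) ^ 5 * r ^ p.2)) :=
    fun p w hw => rr_term_le hK (by simpa using (mem_ball_zero_iff.mp hw).le) hr1 p
  have hd : ∀ p : ℕ × ℕ, DifferentiableOn ℂ
      (fun w => c p.1 p.2 * w ^ ((p.1 + 1) * (p.2 + 1))) (Metric.ball (0 : ℂ) r) :=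
    fun p => by fun_prop
  have h1 := Complex.differentiableOn_tsum_of_summable_norm hu hd hU hle
  have h2 := Complex.hasSum_deriv_of_summable_norm hu hd hU hle hz
  refine ⟨deriv (rrLam c) q, (h1.differentiableAt (hU.mem_nhds hz)).hasDerivAt, ?_⟩
  refine ((h2.mul_left q).tsum_eq.symm.trans (tsum_congr fun p => ?_) :)
  rw [deriv_const_mul_field, deriv_pow_field]
  have : (p.1 + 1) * (p.2 + 1) = (p.1 + 1) * (p.2 + 1) - 1 + 1 := by
    have : 0 < (p.1 + 1) * (p.2 + 1) := by positivity
    omega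
  conv_rhs => rw [this, pow_succ]
  push_cast
  ring

/-- The nome. -/
noncomputable def rrE (τ : ℂ) : ℂ := Complex.exp (2 * (Real.pi : ℂ) * I * τ)

lemma rrE_norm {τ : ℂ} (h : 0 < τ.im) : ‖rrE τ‖ < 1 := by
  rw [rrE, Complex.norm_exp, Real.exp_lt_one_iff]
  simp
  positivity

lemma rrE_deriv {c : ℕ → ℕ → ℂ} (hc : rrPB c) {τ : ℂ} (h : 0 < τ.im) :
    HasDerivAt (fun z => rrLam c (rrE z)) (2 * (Real.pi : ℂ) * I *
      rrLam (fun n k => ((n : ℂ) + 1) * (k + 1) * c n k) (rrE τ)) τ := by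
  obtain ⟨d, hd, hd2⟩ := rrLam_deriv hc (rrE_norm h)
  have h1 : HasDerivAt rrE (rrE τ * (2 * (Real.pi : ℂ) * I)) τ := by
    have := ((hasDerivAt_id τ).const_mul (2 * (Real.pi : ℂ) * I)).cexp
    rw [id, mul_one] at this
    exact this
  have := hd.comp τ h1
  convert! this using 1
  rw [← hd2]; ring

/-- The exponential form of a character. -/
noncomputable def rrCh (t : ℕ) (h τ : ℂ) : ℂ :=
  Complex.exp (2 * (Real.pi : ℂ) * I * h * τ + rrLam (fun n k => rrC t n / (k + 1)) (rrE τ))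

lemma rrPB_div (t : ℕ) : rrPB fun n k => rrC t n / (k + 1) := by
  refine ⟨1, fun n k => ?_⟩
  have e2 : ‖((k : ℂ) + 1)‖ = (k : ℝ) + 1 := by exact_mod_cast Complex.norm_natCast (k + 1)
  rw [norm_div, e2]
  have h1 : ‖rrC t n‖ ≤ 1 := rrX_le _
  have h2 : ‖rrC t n‖ / ((k : ℝ) + 1) ≤ 1 := by
    rw [div_le_one (by positivity)]; linarith [Nat.cast_nonneg (α := ℝ) k]
  have h3 : (1 : ℝ) ≤ ((n : ℝ) + 1) ^ 5 := one_le_pow₀ (by simp)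
  have h4 : (1 : ℝ) ≤ ((k : ℝ) + 1) ^ 5 := one_le_pow₀ (by simp)
  nlinarith

lemma rrCh_deriv (t : ℕ) (h : ℂ) {τ : ℂ} (hτ : 0 < τ.im) :
    HasDerivAt (rrCh t h) (2 * (Real.pi : ℂ) * I *
      ((h + rrLam (rrM (rrC t) 1 0) (rrE τ)) * rrCh t h τ)) τ := by
  have h1 := rrE_deriv (rrPB_div t) hτ
  have e : (fun n k : ℕ => ((n : ℂ) + 1) * (k + 1) * (rrC t n / (k + 1))) = rrM (rrC t) 1 0 := by
    funext n k
    have : (k : ℂ) + 1 ≠ 0 := by exact_mod_cast Nat.succ_ne_zero k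
    rw [rrM]; field_simp
  rw [e] at h1
  have := (((hasDerivAt_id τ).const_mul (2 * (Real.pi : ℂ) * I * h)).add h1).cexp
  convert! this using 1
  simp only [rrCh, id, Pi.add_apply]
  ring

lemma rr_pi_ne : (2 * (Real.pi : ℂ) * I) ≠ 0 := by
  simp [Real.pi_ne_zero]

lemma rr_ramD {f : ℂ → ℂ} {d τ : ℂ} (h : HasDerivAt f (2 * (Real.pi : ℂ) * I * d) τ) :
    ramD f τ = d := by
  rw [ramD, h.deriv, inv_mul_cancel_left₀ rr_pi_ne]

lemma rr_ode (t : ℕ) (h : ℂ) (f : ℂ → ℂ) (hf : ∀ τ : ℂ, 0 < τ.im → f τ = rrCh t h τ)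
    {τ : ℂ} (hτ : 0 < τ.im) :
    ramD f τ = (h + rrLam (rrM (rrC t) 1 0) (rrE τ)) * f τ ∧
    ramD (ramD f) τ = (rrLam (rrM (rrC t) 2 1) (rrE τ) +
      (h + rrLam (rrM (rrC t) 1 0) (rrE τ)) ^ 2) * f τ := by
  have hopen : IsOpen {z : ℂ | 0 < z.im} := isOpen_lt continuous_const Complex.continuous_im
  have hd : ∀ z : ℂ, 0 < z.im → HasDerivAt f (2 * (Real.pi : ℂ) * I *
      ((h + rrLam (rrM (rrC t) 1 0) (rrE z)) * f z)) z := by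
    intro z hz
    rw [hf z hz]
    refine (rrCh_deriv t h hz).congr_of_eventuallyEq ?_
    filter_upwards [hopen.mem_nhds hz] with w hw using hf w hw
  refine ⟨rr_ramD (hd τ hτ), ?_⟩
  have h1 := rrE_deriv (rrM_PB (rrC t) (fun n => rrX_le _) 1 0 (by norm_num) (by norm_num)) hτ
  have e : (fun n k : ℕ => ((n : ℂ) + 1) * (k + 1) * rrM (rrC t) 1 0 n k) = rrM (rrC t) 2 1 := by
    funext n k
    rw [rrM, rrM]; ring
  rw [e] at h1
  have h2 := (h1.const_add h).mul (hd τ hτ)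
  refine rr_ramD ?_
  refine HasDerivAt.congr_of_eventuallyEq (f := fun z =>
    (h + rrLam (rrM (rrC t) 1 0) (rrE z)) * f z) ?_ ?_
  · convert! h2 using 1
    ring
  · filter_upwards [hopen.mem_nhds hτ] with w hw using rr_ramD (hd w hw)

lemma rr_eis (i : ℕ) (hi : i ≤ 5) {q : ℂ} (hq : ‖q‖ < 1) :
    ∑' n : ℕ, ((n : ℂ) + 1) ^ i * q ^ (n + 1) / (1 - q ^ (n + 1)) =
      rrLam (rrM (fun _ => 1) i 0) q := by
  have hs := rrLam_summable (rrM_PB (fun _ => 1) (fun n => by simp) i 0 hi (by norm_num)) hq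
  rw [rrLam, hs.tsum_prod]
  refine tsum_congr fun n => ?_
  have hn : ‖q ^ (n + 1)‖ < 1 := by
    rw [norm_pow]; exact pow_lt_one₀ (norm_nonneg q) hq (by simp)
  rw [div_eq_mul_inv, ← tsum_geometric_of_norm_lt_one hn, ← tsum_mul_left]
  refine tsum_congr fun k => ?_
  rw [rrM, pow_mul]
  ring

lemma rr_GTwo {τ : ℂ} (hτ : 0 < τ.im) :
    GTwo τ = -(1 / 12) + 2 * rrLam (rrM (fun _ => 1) 1 0) (rrE τ) := by
  rw [GTwo, ← rr_eis 1 (by norm_num) (rrE_norm hτ)]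
  simp only [pow_one, rrE]

lemma rr_GFour {τ : ℂ} (hτ : 0 < τ.im) :
    GFour τ = 1 / 720 + 1 / 3 * rrLam (rrM (fun _ => 1) 3 0) (rrE τ) := by
  rw [GFour, ← rr_eis 3 (by norm_num) (rrE_norm hτ)]
  rfl

/-! ### Product formula -/

lemma rr_progr {a b : ℕ} (ha : a < 5) (hb : b < 5) (hab : a ≠ b) (c : ℕ → ℂ)
    (h1 : ∀ n, n % 5 = a → c n = 1) (h2 : ∀ n, n % 5 = b → c n = 1)
    (h3 : ∀ n, n % 5 ≠ a → n % 5 ≠ b → c n = 0) (f : ℕ → ℂ)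
    (hs : Summable f) :
    HasSum (fun n => f (5 * n + a) + f (5 * n + b)) (∑' n, c n * f n) := by
  have ia : Function.Injective fun n : ℕ => 5 * n + a := fun m n h => by simpa using h
  have ib : Function.Injective fun n : ℕ => 5 * n + b := fun m n h => by simpa using h
  have sa := (hs.comp_injective ia)
  have sb := (hs.comp_injective ib)
  let fa : ℕ → ℂ := fun n => if n % 5 = a then f n else 0
  let fb : ℕ → ℂ := fun n => if n % 5 = b then f n else 0
  have ea : ∀ n, fa (5 * n + a) = f (5 * n + a) := fun n => by simp [fa, Nat.mod_eq_of_lt ha]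
  have eb : ∀ n, fb (5 * n + b) = f (5 * n + b) := fun n => by simp [fb, Nat.mod_eq_of_lt hb]
  have ha' : HasSum fa (∑' n, f (5 * n + a)) := by
    refine (ia.hasSum_iff (f := fa) ?_).mp ?_
    · intro n hn
      have : n % 5 ≠ a := fun h => hn ⟨n / 5, by simp only; omega⟩
      simp [fa, this]
    · have e : fa ∘ (fun n : ℕ => 5 * n + a) = f ∘ fun n : ℕ => 5 * n + a := funext ea
      rw [e]
      exact sa.hasSum
  have hb' : HasSum fb (∑' n, f (5 * n + b)) := by
    refine (ib.hasSum_iff (f := fb) ?_).mp ?_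
    · intro n hn
      have : n % 5 ≠ b := fun h => hn ⟨n / 5, by simp only; omega⟩
      simp [fb, this]
    · have e : fb ∘ (fun n : ℕ => 5 * n + b) = f ∘ fun n : ℕ => 5 * n + b := funext eb
      rw [e]
      exact sb.hasSum
  have e : (fun n => c n * f n) = fun n => fa n + fb n := by
    funext n
    by_cases hna : n % 5 = a
    · have : n % 5 ≠ b := by omega
      simp [fa, fb, hna, h1 n hna, hab]
    · by_cases hnb : n % 5 = b
      · simp [fa, fb, hnb, h2 n hnb, hab.symm]
      · simp [fa, fb, hna, hnb, h3 n hna hnb]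
  rw [e, (ha'.add hb').tsum_eq]
  exact sa.hasSum.add sb.hasSum

lemma rr_product (t : ℕ) {a b : ℕ} (ha : a < 4) (hb : b < 4) (hab : a ≠ b)
    (h1 : ∀ n, n % 5 = a → rrC t n = 1) (h2 : ∀ n, n % 5 = b → rrC t n = 1)
    (h3 : ∀ n, n % 5 ≠ a → n % 5 ≠ b → rrC t n = 0) {q : ℂ} (hq : ‖q‖ < 1) :
    ∏' n : ℕ, ((1 - q ^ (5 * n + a + 1))⁻¹ * (1 - q ^ (5 * n + b + 1))⁻¹) =
      Complex.exp (rrLam (fun n k => rrC t n / (k + 1)) q) := by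
  have hn : ∀ n, ‖q ^ (n + 1)‖ < 1 := fun n => by
    rw [norm_pow]; exact pow_lt_one₀ (norm_nonneg q) hq (by simp)
  have hpb : rrPB fun n k => 1 / ((k : ℂ) + 1) := by
    refine ⟨1, fun n k => ?_⟩
    have e2 : ‖((k : ℂ) + 1)‖ = (k : ℝ) + 1 := by exact_mod_cast Complex.norm_natCast (k + 1)
    rw [norm_div, e2, norm_one]
    have h2 : 1 / ((k : ℝ) + 1) ≤ 1 := by
      rw [div_le_one (by positivity)]; linarith [Nat.cast_nonneg (α := ℝ) k]
    have h3 : (1 : ℝ) ≤ ((n : ℝ) + 1) ^ 5 := one_le_pow₀ (by simp)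
    have h4 : (1 : ℝ) ≤ ((k : ℝ) + 1) ^ 5 := one_le_pow₀ (by simp)
    nlinarith
  have hlog : ∀ n, HasSum (fun k : ℕ => 1 / ((k : ℂ) + 1) * q ^ ((n + 1) * (k + 1)))
      (-Complex.log (1 - q ^ (n + 1))) := fun n => by
    refine Eq.mp (congrArg (fun f => HasSum f _) (funext fun k => ?_))
      (Complex.hasSum_taylorSeries_neg_log' (hn n))
    rw [pow_mul]; ring
  have hs : Summable fun n : ℕ => -Complex.log (1 - q ^ (n + 1)) :=
    ((rrLam_summable hpb hq).prod).congr fun n => (hlog n).tsum_eq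
  have hL : rrLam (fun n k => rrC t n / (k + 1)) q =
      ∑' n, rrC t n * -Complex.log (1 - q ^ (n + 1)) := by
    rw [rrLam, (rrLam_summable (rrPB_div t) hq).tsum_prod]
    refine tsum_congr fun n => ?_
    rw [← (hlog n).tsum_eq, ← tsum_mul_left]
    exact tsum_congr fun k => by ring
  have hP := (rr_progr (by omega) (by omega) hab (rrC t) h1 h2 h3 _ hs).cexp
  rw [hL, ← hP.tprod_eq]
  have hexp : ∀ n, Complex.exp (-Complex.log (1 - q ^ (n + 1))) = (1 - q ^ (n + 1))⁻¹ := by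
    intro n
    rw [Complex.exp_neg, Complex.exp_log]
    intro h0
    have := hn n
    rw [← sub_eq_zero.mp h0] at this
    simp at this
  refine tprod_congr fun n => ?_
  simp only [Function.comp_apply]
  rw [Complex.exp_add, hexp, hexp]

lemma rr_chOne {τ : ℂ} (hτ : 0 < τ.im) : chOne τ = rrCh 1 (11 / 60) τ := by
  have := rr_product 1 (a := 1) (b := 2) (by norm_num) (by norm_num) (by norm_num)
    (fun n h => by simp [rrC, rrX]; omega) (fun n h => by simp [rrC, rrX]; omega)
    (fun n h h' => by simp [rrC, rrX]; omega) (rrE_norm hτ)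
  rw [chOne, rrCh, Complex.exp_add, ← this]
  rfl

lemma rr_chTwo {τ : ℂ} (hτ : 0 < τ.im) : chTwo τ = rrCh 2 (-(1 / 60)) τ := by
  have := rr_product 2 (a := 0) (b := 3) (by norm_num) (by norm_num) (by norm_num)
    (fun n h => by simp [rrC, rrX]; omega) (fun n h => by simp [rrC, rrX]; omega)
    (fun n h h' => by simp [rrC, rrX]; omega) (rrE_norm hτ)
  rw [chTwo, rrCh, Complex.exp_add, ← this]
  congr 2
  ring

lemma rrE_add_one (τ : ℂ) : rrE (τ + 1) = rrE τ := by
  rw [rrE, rrE, mul_add, mul_one, Complex.exp_periodic]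

lemma rrCh_add_one (t : ℕ) (h τ : ℂ) :
    rrCh t h (τ + 1) = Complex.exp (2 * (Real.pi : ℂ) * I * h) * rrCh t h τ := by
  rw [rrCh, rrCh, rrE_add_one, ← Complex.exp_add]
  congr 1
  ring

lemma rr_indep : LinearIndependent ℂ ![UHP.restrict chOne, UHP.restrict chTwo] := by
  rw [LinearIndependent.pair_iff]
  intro s u hsu
  have key : ∀ τ : ℂ, 0 < τ.im → s * rrCh 1 (11 / 60) τ + u * rrCh 2 (-(1 / 60)) τ = 0 := by
    intro τ hτ
    have := congrFun hsu ⟨τ, hτ⟩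
    simpa [Set.restrict, rr_chOne hτ, rr_chTwo hτ] using this
  have k1 := key I (by simp)
  have k2 := key (I + 1) (by simp)
  rw [rrCh_add_one, rrCh_add_one] at k2
  have n1 : rrCh 1 (11 / 60) I ≠ 0 := Complex.exp_ne_zero _
  have n2 : rrCh 2 (-(1 / 60)) I ≠ 0 := Complex.exp_ne_zero _
  have hne : Complex.exp (2 * (Real.pi : ℂ) * I * (11 / 60)) ≠
      Complex.exp (2 * (Real.pi : ℂ) * I * (-(1 / 60))) := by
    intro h
    rw [Complex.exp_eq_exp_iff_exists_int] at h
    obtain ⟨n, hn⟩ := h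
    have h5 : (2 * (Real.pi : ℂ) * I) * (1 - 5 * n) = 0 := by linear_combination 5 * hn
    have h6 : (1 : ℂ) - 5 * n = 0 := (mul_eq_zero.mp h5).resolve_left rr_pi_ne
    have h7 : (1 : ℤ) - 5 * n = 0 := by exact_mod_cast h6
    omega
  have hs : s = 0 := by
    have : s * (rrCh 1 (11 / 60) I * (Complex.exp (2 * (Real.pi : ℂ) * I * (11 / 60)) -
      Complex.exp (2 * (Real.pi : ℂ) * I * (-(1 / 60))))) = 0 := by
      linear_combination k2 - Complex.exp (2 * (Real.pi : ℂ) * I * (-(1 / 60))) * k1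
    exact (mul_eq_zero.mp this).resolve_right (mul_ne_zero n1 (sub_ne_zero.mpr hne))
  refine ⟨hs, ?_⟩
  rw [hs, zero_mul, zero_add] at k1
  exact (mul_eq_zero.mp k1).resolve_right n2

/-- `ch₁` and `ch₂` are linearly independent over `ℂ` and form a
fundamental system of solutions of `Θ²y − (11/5)G₄ y = 0`, i.e. each satisfies
`(q d/dq)²y + 2·G₂·(q d/dq)y − (11/5)·G₄·y = 0` on `ℍ`. -/
theorem stmt_13 :
    LinearIndependent ℂ ![UHP.restrict chOne, UHP.restrict chTwo] ∧
    (∀ τ : ℂ, 0 < τ.im →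
      ramD (ramD chOne) τ + 2 * GTwo τ * ramD chOne τ - (11 / 5) * GFour τ * chOne τ = 0) ∧
    (∀ τ : ℂ, 0 < τ.im →
      ramD (ramD chTwo) τ + 2 * GTwo τ * ramD chTwo τ - (11 / 5) * GFour τ * chTwo τ = 0) := by
  refine ⟨rr_indep, fun τ hτ => ?_, fun τ hτ => ?_⟩
  · obtain ⟨h1, h2⟩ := rr_ode 1 (11 / 60) chOne (fun _ h => rr_chOne h) hτ
    rw [h2, h1, rr_GTwo hτ, rr_GFour hτ]
    linear_combination chOne τ * rr_ric_one (rrE_norm hτ)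
  · obtain ⟨h1, h2⟩ := rr_ode 2 (-(1 / 60)) chTwo (fun _ h => rr_chTwo h) hτ
    rw [h2, h1, rr_GTwo hτ, rr_GFour hτ]
    linear_combination chTwo τ * rr_ric_two (rrE_norm hτ)
end

section
/- The functions 𝔣⁸ and 𝔣₂⁸ are linearly independent over ℂ and each of y = 𝔣⁸ and y = 𝔣₂⁸ satisfies the second-order differential equation (q d/dq)²y + 2·G₂·(q d/dq)y − 40·G₄·y = 0 on ℍ; i.e., they form a fundamental system of solutions of Θ²y − 40·G₄ y = 0. -/
open Complex

/-- The eighth power of the Weber function: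
`𝔣(τ)⁸ = e^{−πiτ/3} ∏_{n≥1}(1 + e^{2πi(n−1/2)τ})⁸`. -/
noncomputable def weberF8 (τ : ℂ) : ℂ :=
  Complex.exp (-((Real.pi : ℂ) * I * τ / 3)) *
    ∏' n : ℕ, (1 + Complex.exp (2 * (Real.pi : ℂ) * I * ((n : ℂ) + 1 / 2) * τ)) ^ 8

/-- The eighth power of the Weber function `𝔣₂(τ)⁸ = e^{2πiτ/3} ∏_{n≥1}(1 + qⁿ)⁸`. -/
noncomputable def weberF28 (τ : ℂ) : ℂ :=
  Complex.exp (2 * (Real.pi : ℂ) * I * τ / 3) *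
    ∏' n : ℕ, (1 + Complex.exp (2 * (Real.pi : ℂ) * I * τ) ^ (n + 1)) ^ 8

section Weber
open UpperHalfPlane hiding I
open scoped Manifold MatrixGroups ModularForm Topology Real
open Filter Derivative

noncomputable section

lemma denom_S' (z : ℍ) : denom (ModularGroup.S : GL (Fin 2) ℝ) z = z := by
  rw [ModularGroup.denom_apply]; simp [ModularGroup.S]

lemma denom_T' (z : ℍ) : denom (ModularGroup.T : GL (Fin 2) ℝ) z = 1 := by
  rw [ModularGroup.denom_apply]; simp [ModularGroup.T]

lemma slash_T_apply (k : ℤ) (f : ℍ → ℂ) (z : ℍ) :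
    (f ∣[k] ModularGroup.T) z = f ((1 : ℝ) +ᵥ z) := by
  rw [ModularForm.SL_slash_apply, UpperHalfPlane.modular_T_smul, denom_T']
  simp

lemma slash_S_apply (k : ℤ) (f : ℍ → ℂ) (z : ℍ) :
    (f ∣[k] ModularGroup.S) z = f (ModularGroup.S • z) * (z : ℂ) ^ (-k) := by
  rw [ModularForm.SL_slash_apply, denom_S']

/-- `E₂` extended to `ℂ`. -/
def wE2 (z : ℂ) : ℂ := EisensteinSeries.E2 (ofComplex z)

lemma wE2_coe (z : ℍ) : wE2 z = EisensteinSeries.E2 z := by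
  simp [wE2, ofComplex_apply]

lemma wE2_diff {z : ℂ} (hz : 0 < z.im) : DifferentiableAt ℂ wE2 z :=
  UpperHalfPlane.mdifferentiableAt_iff.mp (E2_mdifferentiable ⟨z, hz⟩)

lemma wE2_T {z : ℂ} (hz : 0 < z.im) : wE2 (z + 1) = wE2 z := by
  have h := congrFun (EisensteinSeries.E2_slash_action ModularGroup.T) ⟨z, hz⟩
  rw [EisensteinSeries.D2_T, slash_T_apply] at h
  have h2 : wE2 (z + 1) = EisensteinSeries.E2 ((1 : ℝ) +ᵥ (⟨z, hz⟩ : ℍ)) := by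
    rw [← wE2_coe]; simp [add_comm]
  have h3 : wE2 z = EisensteinSeries.E2 ⟨z, hz⟩ := wE2_coe ⟨z, hz⟩
  rw [h2, h3]
  simpa using h

lemma wE2_S {z : ℂ} (hz : 0 < z.im) :
    wE2 (-1 / z) = z ^ 2 * wE2 z - (1 / (2 * riemannZeta 2)) * (2 * π * Complex.I) * z := by
  have h := congrFun (EisensteinSeries.E2_slash_action ModularGroup.S) ⟨z, hz⟩
  rw [slash_S_apply, UpperHalfPlane.modular_S_smul, Pi.sub_apply, Pi.smul_apply,
    EisensteinSeries.D2_S, ← wE2_coe, ← wE2_coe] at h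
  have hz0 : z ≠ 0 := by rintro rfl; simp at hz
  have e : (-z)⁻¹ = -1 / z := by field_simp
  simp only [e] at h
  simp only [smul_eq_mul] at h
  rw [show (-2 : ℤ) = -((2 : ℕ) : ℤ) by rfl, zpow_neg, zpow_natCast] at h
  field_simp at h ⊢
  linear_combination h

/-- `2 E₂(2z) - E₂(z)`. -/
def wA (z : ℂ) : ℂ := 2 * wE2 (2 * z) - wE2 z

lemma im_two_mul {z : ℂ} (hz : 0 < z.im) : 0 < (2 * z).im := by simpa using hz
lemma im_half {z : ℂ} (hz : 0 < z.im) : 0 < (z / 2).im := by simpa using hz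
lemma im_half' {z : ℂ} (hz : 0 < z.im) : 0 < ((z + 1) / 2).im := by simpa using hz
lemma im_inv' {z : ℂ} (hz : 0 < z.im) : 0 < (-1 / z).im := by
  have := (ModularGroup.S • (⟨z, hz⟩ : ℍ)).im_pos
  rw [UpperHalfPlane.modular_S_smul] at this
  have e : (-z)⁻¹ = -1 / z := by rw [inv_neg, neg_div, one_div]
  rw [← e]; exact this

lemma wA_diff {z : ℂ} (hz : 0 < z.im) : DifferentiableAt ℂ wA z := by
  have h1 : DifferentiableAt ℂ (fun z => wE2 (2 * z)) z :=
    DifferentiableAt.comp (g := wE2) z (wE2_diff (im_two_mul hz)) (by fun_prop)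
  exact (h1.const_mul 2).sub (wE2_diff hz)

lemma wA_T {z : ℂ} (hz : 0 < z.im) : wA (z + 1) = wA z := by
  unfold wA
  rw [wE2_T hz, show 2 * (z + 1) = (2 * z + 1) + 1 by ring, wE2_T, wE2_T (im_two_mul hz)]
  simpa using hz

lemma wA_S {z : ℂ} (hz : 0 < z.im) : wA (-1 / z) = z ^ 2 * (-(1 / 2) * wA (z / 2)) := by
  have hz0 : z ≠ 0 := by rintro rfl; simp at hz
  unfold wA
  rw [wE2_S hz, show 2 * (-1 / z) = -1 / (z / 2) by field_simp, wE2_S (im_half hz),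
    show 2 * (z / 2) = z by ring]
  ring

lemma wA_S' {z : ℂ} (hz : 0 < z.im) : wA ((-1 / z) / 2) = z ^ 2 * (-2 * wA z) := by
  have hz0 : z ≠ 0 := by rintro rfl; simp at hz
  rw [show -1 / z / 2 = -1 / (2 * z) by field_simp, wA_S (im_two_mul hz),
    show 2 * z / 2 = z by ring]
  ring

lemma wA_STS {z : ℂ} (hz : 0 < z.im) :
    wA ((-1 / z + 1) / 2) = z ^ 2 * wA ((z + 1) / 2) := by
  have hz0 : z ≠ 0 := by rintro rfl; simp at hz
  have hz1 : 0 < (z - 1).im := by simpa using hz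
  have hz10 : z - 1 ≠ 0 := by intro h; rw [h] at hz1; simp at hz1
  have hs : 0 < (-1 / (z - 1)).im := im_inv' hz1
  have e1 : (-1 / z + 1) / 2 = -1 / (2 * (-1 / (z - 1) - 1)) := by
    have : -1 / (z - 1) - 1 = - z / (z - 1) := by field_simp; ring
    rw [this]; field_simp; ring
  have hs' : 0 < (-1 / (z - 1) - 1).im := by
    rw [Complex.sub_im, Complex.one_im, sub_zero]; exact hs
  rw [e1, wA_S (im_two_mul hs'), show 2 * (-1 / (z - 1) - 1) / 2 = -1 / (z - 1) - 1 by ring,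
    ← wA_T hs', show -1 / (z - 1) - 1 + 1 = -1 / (z - 1) by ring, wA_S hz1,
    ← wA_T (im_half hz1), show (z - 1) / 2 + 1 = (z + 1) / 2 by ring]
  field_simp
  ring

/-- the three conjugates -/
def wA0 (z : ℍ) : ℂ := wA z
def wA1 (z : ℍ) : ℂ := -(1 / 2) * wA (z / 2)
def wA2 (z : ℍ) : ℂ := -(1 / 2) * wA ((z + 1) / 2)

lemma coe_S_smul (z : ℍ) : ((ModularGroup.S • z : ℍ) : ℂ) = -1 / z := by
  rw [UpperHalfPlane.modular_S_smul]
  change (-(z : ℂ))⁻¹ = _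
  rw [inv_neg, neg_div, one_div]

lemma wA0_T : wA0 ∣[(2 : ℤ)] ModularGroup.T = wA0 := by
  ext z
  rw [slash_T_apply]; simp only [wA0]
  rw [← wA_T z.im_pos]; simp [add_comm]

lemma wA1_T : wA1 ∣[(2 : ℤ)] ModularGroup.T = wA2 := by
  ext z
  rw [slash_T_apply]; simp only [wA1, wA2]
  simp [add_comm]

lemma wA2_T : wA2 ∣[(2 : ℤ)] ModularGroup.T = wA1 := by
  ext z
  rw [slash_T_apply]; simp only [wA1, wA2]
  rw [← wA_T (im_half z.im_pos)]
  congr 2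
  simp; ring

lemma zpow_neg_two' (z : ℍ) : (z : ℂ) ^ (-2 : ℤ) = ((z : ℂ) ^ 2)⁻¹ := by
  rw [show (-2 : ℤ) = -((2 : ℕ) : ℤ) by rfl, zpow_neg, zpow_natCast]

lemma wA0_S : wA0 ∣[(2 : ℤ)] ModularGroup.S = wA1 := by
  ext z
  rw [slash_S_apply, zpow_neg_two']; simp only [wA0, wA1]
  rw [coe_S_smul, wA_S z.im_pos]
  have := UpperHalfPlane.ne_zero z
  field_simp

lemma wA1_S : wA1 ∣[(2 : ℤ)] ModularGroup.S = wA0 := by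
  ext z
  rw [slash_S_apply, zpow_neg_two']; simp only [wA0, wA1]
  rw [coe_S_smul, wA_S' z.im_pos]
  have := UpperHalfPlane.ne_zero z
  field_simp

lemma wA2_S : wA2 ∣[(2 : ℤ)] ModularGroup.S = wA2 := by
  ext z
  rw [slash_S_apply, zpow_neg_two']; simp only [wA2]
  rw [coe_S_smul, wA_STS z.im_pos]
  have := UpperHalfPlane.ne_zero z
  field_simp

lemma tendsto_of_periodic {f : ℍ → ℂ} {c : ℕ → ℂ}
    (hfper : Function.Periodic (f ∘ ofComplex) ((1 : ℝ) : ℂ)) (hfhol : MDiff f)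
    (hfbdd : IsBoundedAtImInfty f)
    (hf : ∀ τ : ℍ, HasSum (fun m ↦ c m • Function.Periodic.qParam 1 τ ^ m) (f τ)) :
    Tendsto f atImInfty (𝓝 (c 0)) := by
  have han := analyticAt_cuspFunction_zero one_pos hfper hfhol hfbdd
  have h1 := hasFPowerSeriesOnBall_cuspFunction one_pos han hf
  have h2 : UpperHalfPlane.cuspFunction 1 f 0 = c 0 := by
    have := h1.coeff_zero (fun _ => 0)
    rw [← this]
    simp [FormalMultilinearSeries.ofScalars]
  have h3 := (han.continuousAt.tendsto).comp (qParam_tendsto_atImInfty one_pos)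
  rw [h2] at h3
  refine h3.congr fun z => ?_
  exact eq_cuspFunction z one_ne_zero hfper

lemma E2_per : Function.Periodic (EisensteinSeries.E2 ∘ ofComplex) ((1 : ℝ) : ℂ) := by
  intro z
  by_cases hz : 0 < z.im
  · simpa [wE2] using wE2_T hz
  · have h2 : ¬ 0 < (z + ((1 : ℝ) : ℂ)).im := by simpa using hz
    simp only [Function.comp_apply]
    rw [ofComplex_apply_of_im_nonpos (not_lt.mp hz), ofComplex_apply_of_im_nonpos (not_lt.mp h2)]

lemma E2_tendsto : Tendsto EisensteinSeries.E2 atImInfty (𝓝 1) := by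
  have := tendsto_of_periodic (f := EisensteinSeries.E2) E2_per E2_mdifferentiable
    EisensteinSeries.isBoundedAtImInfty_E2
    (c := fun m => (if m = 0 then 1 else -24 * (ArithmeticFunction.sigma 1 m : ℂ))) (fun τ => by
      simpa only [Function.Periodic.qParam, Complex.ofReal_one, div_one] using
        EisensteinSeries.hasSum_qExpansion_E2 (z := τ))
  simpa using this

/-- `E₄` as a function. -/
def wE4 : ModularForm 𝒮ℒ 4 := ModularForm.E (k := 4) (by norm_num)

lemma E4_tendsto : Tendsto wE4 atImInfty (𝓝 1) := by
  have h0 := tendsto_of_periodic (f := wE4)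
    (SlashInvariantFormClass.periodic_comp_ofComplex wE4 one_mem_strictPeriods_SL)
    (ModularFormClass.holo wE4) (ModularFormClass.bdd_at_infty wE4)
    (c := fun m => (qExpansion 1 wE4).coeff m)
    (fun τ => by simpa using ModularForm.hasSum_qExpansion (f := wE4) one_pos one_mem_strictPeriods_SL τ)
  have h1 : (qExpansion 1 wE4).coeff 0 = 1 :=
    EisensteinSeries.E_qExpansion_coeff_zero (k := 4) (by norm_num) ⟨2, rfl⟩
  simpa [h1] using h0

/-- filter at `i∞` in `ℂ` -/
abbrev wInf : Filter ℂ := comap Complex.im atTop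

lemma wE2_tendsto : Tendsto wE2 wInf (𝓝 1) := E2_tendsto.comp tendsto_comap_im_ofComplex

lemma wA_tendsto : Tendsto wA wInf (𝓝 1) := by
  have h : Tendsto (fun z : ℂ => 2 * z) wInf wInf := by
    rw [tendsto_comap_iff]
    have : (Complex.im ∘ fun z : ℂ => 2 * z) = fun z : ℂ => 2 * z.im := by ext; simp
    rw [this]
    exact tendsto_comap.const_mul_atTop (by norm_num)
  have := ((wE2_tendsto.comp h).const_mul 2).sub wE2_tendsto
  convert this using 2
  · rfl
  · norm_num

lemma wA_half_tendsto (a : ℝ) : Tendsto (fun z : ℂ => -(1 / 2) * wA ((z + a) / 2)) wInf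
    (𝓝 (-(1 / 2))) := by
  have h : Tendsto (fun z : ℂ => (z + a) / 2) wInf wInf := by
    rw [tendsto_comap_iff]
    have : (Complex.im ∘ fun z : ℂ => (z + a) / 2) = fun z : ℂ => z.im / 2 := by ext; simp
    rw [this]
    exact tendsto_comap.atTop_div_const (by norm_num)
  have := (wA_tendsto.comp h).const_mul (-(1 / 2))
  simpa using this

lemma deriv_tendsto {F : ℂ → ℂ} {c : ℂ} (hF : ∀ z : ℂ, 0 < z.im → DifferentiableAt ℂ F z)
    (h : Tendsto F wInf (𝓝 c)) : Tendsto (deriv F) wInf (𝓝 0) := by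
  have hb : ∀ᶠ z in wInf, ‖F z‖ ≤ ‖c‖ + 1 := by
    have := h.norm.eventually (Iic_mem_nhds (lt_add_one ‖c‖))
    simpa using this
  rw [eventually_comap, eventually_atTop] at hb
  obtain ⟨M, hM⟩ := hb
  set M' := max M 1
  have key : ∀ z : ℂ, 2 * M' ≤ z.im → ‖deriv F z‖ ≤ (‖c‖ + 1) / (z.im / 2) := by
    intro z hz
    have hM1 : 1 ≤ M' := le_max_right _ _
    have hpos : 0 < z.im / 2 := by linarith
    have him : ∀ w ∈ Metric.closedBall z (z.im / 2), M' ≤ w.im := by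
      intro w hw
      rw [Metric.mem_closedBall, dist_eq_norm] at hw
      have := (Complex.abs_im_le_norm (w - z)).trans hw
      rw [Complex.sub_im, abs_le] at this
      linarith [this.1]
    refine Complex.norm_deriv_le_of_forall_mem_sphere_norm_le hpos ?_ ?_
    · apply DifferentiableOn.diffContOnCl
      rw [closure_ball _ hpos.ne']
      intro w hw
      exact (hF w (by linarith [him w hw])).differentiableWithinAt
    · intro w hw
      exact hM w.im ((le_max_left _ _).trans (him w (Metric.sphere_subset_closedBall hw))) w rfl
  refine squeeze_zero_norm' (a := fun z : ℂ => (‖c‖ + 1) / (z.im / 2)) ?_ ?_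
  · rw [eventually_comap, eventually_atTop]
    exact ⟨2 * M', fun b hb z hz => key z (by rw [hz]; exact hb)⟩
  · exact tendsto_const_nhds.div_atTop (tendsto_comap.atTop_div_const (by norm_num))

/-- The Riccati expression. -/
def wR (f : ℍ → ℂ) : ℍ → ℂ :=
  (6 : ℂ) • serreDerivative 2 f + (2 : ℂ) • (f * f) + (-1 : ℂ) • (wE4 : ℍ → ℂ)

lemma comp_ofComplex_eventuallyEq (F : ℂ → ℂ) {z : ℂ} (hz : 0 < z.im) :
    ((fun w : ℍ => F w) ∘ ofComplex) =ᶠ[𝓝 z] F := by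
  filter_upwards [isOpen_upperHalfPlaneSet.mem_nhds hz] with w hw
  simp [ofComplex_apply_of_im_pos hw]

lemma D_eq (F : ℂ → ℂ) (z : ℍ) :
    normalizedDerivOfComplex (fun w : ℍ => F w) z = (2 * π * Complex.I)⁻¹ * deriv F z := by
  rw [normalizedDerivOfComplex, (comp_ofComplex_eventuallyEq F z.im_pos).deriv_eq]

lemma mdiff_of (F : ℂ → ℂ) (hF : ∀ z : ℂ, 0 < z.im → DifferentiableAt ℂ F z) :
    MDiff (fun w : ℍ => F w) := by
  intro z
  rw [UpperHalfPlane.mdifferentiableAt_iff]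
  exact (hF z z.im_pos).congr_of_eventuallyEq (comp_ofComplex_eventuallyEq F z.im_pos)

lemma coe_tendsto_wInf : Tendsto (fun z : ℍ => (z : ℂ)) atImInfty wInf := by
  rw [tendsto_comap_iff]
  exact tendsto_comap

lemma wR_tendsto (F : ℂ → ℂ) (c : ℂ) (hF : ∀ z : ℂ, 0 < z.im → DifferentiableAt ℂ F z)
    (h : Tendsto F wInf (𝓝 c)) (hc : 2 * c ^ 2 - c - 1 = 0) :
    IsZeroAtImInfty (wR (fun w : ℍ => F w)) := by
  have h1 := (deriv_tendsto hF h).comp coe_tendsto_wInf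
  have h2 := h.comp coe_tendsto_wInf
  have h3 := (((((h1.const_mul (2 * π * Complex.I)⁻¹).sub ((E2_tendsto.const_mul (2 * 12⁻¹)).mul h2)
    ).const_mul 6).add ((h2.mul h2).const_mul 2)).add (E4_tendsto.const_mul (-1)))
  unfold IsZeroAtImInfty ZeroAtFilter
  convert h3 using 2
  · simp [wR, D_eq]
  · linear_combination -hc

lemma wE4_mdiff : MDiff (wE4 : ℍ → ℂ) := ModularFormClass.holo wE4

lemma wR_mdiff {f : ℍ → ℂ} (hf : MDiff f) : MDiff (wR f) :=
  (((serreDerivative_mdifferentiable 2 hf).const_smul (6 : ℂ)).add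
    ((hf.mul hf).const_smul (2 : ℂ))).add (wE4_mdiff.const_smul (-1 : ℂ))

lemma wE4_slash (γ : SL(2, ℤ)) : (wE4 : ℍ → ℂ) ∣[(4 : ℤ)] γ = wE4 :=
  SlashInvariantFormClass.slash_action_eq wE4 _ ⟨γ, rfl⟩

lemma wR_slash {f : ℍ → ℂ} (hf : MDiff f) (γ : SL(2, ℤ)) :
    wR f ∣[(4 : ℤ)] γ = wR (f ∣[(2 : ℤ)] γ) := by
  have h1 := serreDerivative_slash_equivariant (k := 2) hf (γ := γ)
  have h2 := ModularForm.mul_slash_SL2 2 2 γ f f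
  have h1' : serreDerivative 2 f ∣[(4 : ℤ)] γ = serreDerivative 2 (f ∣[(2 : ℤ)] γ) := by
    simpa only [Int.cast_ofNat, show (2 : ℤ) + 2 = 4 from rfl] using h1
  have h2' : (f * f) ∣[(4 : ℤ)] γ = (f ∣[(2 : ℤ)] γ) * (f ∣[(2 : ℤ)] γ) := h2
  unfold wR
  rw [SlashAction.add_slash, SlashAction.add_slash, ModularForm.SL_smul_slash,
    ModularForm.SL_smul_slash, ModularForm.SL_smul_slash, wE4_slash, h2', h1']

lemma wA0_mdiff : MDiff wA0 := mdiff_of wA (fun _ hz => wA_diff hz)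

lemma wAh_diff (a : ℝ) {z : ℂ} (hz : 0 < z.im) :
    DifferentiableAt ℂ (fun z : ℂ => -(1 / 2) * wA ((z + a) / 2)) z := by
  have h1 : DifferentiableAt ℂ (fun z : ℂ => wA ((z + a) / 2)) z :=
    DifferentiableAt.comp (g := wA) z (wA_diff (by simpa using hz)) (by fun_prop)
  exact h1.const_mul _

lemma wA1_eq : wA1 = fun w : ℍ => (fun z : ℂ => -(1 / 2) * wA ((z + (0 : ℝ)) / 2)) w := by
  ext w; simp [wA1]

lemma wA2_eq : wA2 = fun w : ℍ => (fun z : ℂ => -(1 / 2) * wA ((z + (1 : ℝ)) / 2)) w := by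
  ext w; simp [wA2]

lemma wA1_mdiff : MDiff wA1 := by
  rw [wA1_eq]; exact mdiff_of _ (fun _ hz => wAh_diff 0 hz)

lemma wA2_mdiff : MDiff wA2 := by
  rw [wA2_eq]; exact mdiff_of _ (fun _ hz => wAh_diff 1 hz)

lemma R0_zero : IsZeroAtImInfty (wR wA0) :=
  wR_tendsto wA 1 (fun _ hz => wA_diff hz) wA_tendsto (by norm_num)

lemma R1_zero : IsZeroAtImInfty (wR wA1) := by
  rw [wA1_eq]
  exact wR_tendsto (fun z : ℂ => -(1 / 2) * wA ((z + (0 : ℝ)) / 2)) (-(1 / 2)) (fun _ hz => wAh_diff 0 hz) (wA_half_tendsto 0) (by norm_num)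

lemma R2_zero : IsZeroAtImInfty (wR wA2) := by
  rw [wA2_eq]
  exact wR_tendsto (fun z : ℂ => -(1 / 2) * wA ((z + (1 : ℝ)) / 2)) (-(1 / 2)) (fun _ hz => wAh_diff 1 hz) (wA_half_tendsto 1) (by norm_num)

lemma per_of_T {k : ℤ} {f : ℍ → ℂ} (hf : f ∣[k] ModularGroup.T = f) :
    Function.Periodic (f ∘ ofComplex) ((1 : ℝ) : ℂ) := by
  intro z
  by_cases hz : 0 < z.im
  · have h := congrFun hf ⟨z, hz⟩
    rw [slash_T_apply] at h
    have h2 : 0 < (z + ((1 : ℝ) : ℂ)).im := by simpa using hz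
    simp only [Function.comp_apply]
    rw [ofComplex_apply_of_im_pos hz, ofComplex_apply_of_im_pos h2, ← h]
    congr 1
    ext
    simp [add_comm]
  · have h2 : ¬ 0 < (z + ((1 : ℝ) : ℂ)).im := by simpa using hz
    simp only [Function.comp_apply]
    rw [ofComplex_apply_of_im_nonpos (not_lt.mp hz), ofComplex_apply_of_im_nonpos (not_lt.mp h2)]

lemma R0_decay : wR wA0 =O[atImInfty] fun τ ↦ Real.exp (-2 * π * τ.im) := by
  have hp := per_of_T (k := 4) (f := wR wA0) (by rw [wR_slash wA0_mdiff, wA0_T])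
  simpa using IsZeroAtImInfty.exp_decay_atImInfty R0_zero one_pos hp (wR_mdiff wA0_mdiff)
    R0_zero.isBoundedAtImInfty

/-- The product of the three conjugate Riccati expressions. -/
def wP : ℍ → ℂ := wR wA0 * wR wA1 * wR wA2

lemma wP_slash_aux (γ : SL(2, ℤ)) : wP ∣[(12 : ℤ)] γ =
    (wR wA0 ∣[(4 : ℤ)] γ) * (wR wA1 ∣[(4 : ℤ)] γ) * (wR wA2 ∣[(4 : ℤ)] γ) := by
  have h1 := ModularForm.mul_slash_SL2 8 4 γ (wR wA0 * wR wA1) (wR wA2)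
  have h2 := ModularForm.mul_slash_SL2 4 4 γ (wR wA0) (wR wA1)
  rw [← show (wR wA0 * wR wA1) ∣[(8 : ℤ)] γ = _ from h2]
  exact h1

lemma wP_S : wP ∣[(12 : ℤ)] ModularGroup.S = wP := by
  rw [wP_slash_aux, wR_slash wA0_mdiff, wR_slash wA1_mdiff, wR_slash wA2_mdiff,
    wA0_S, wA1_S, wA2_S, wP]
  ring

lemma wP_T : wP ∣[(12 : ℤ)] ModularGroup.T = wP := by
  rw [wP_slash_aux, wR_slash wA0_mdiff, wR_slash wA1_mdiff, wR_slash wA2_mdiff,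
    wA0_T, wA1_T, wA2_T, wP]
  ring

lemma wP_mdiff : MDiff wP :=
  ((wR_mdiff wA0_mdiff).mul (wR_mdiff wA1_mdiff)).mul (wR_mdiff wA2_mdiff)

lemma wP_zero : IsZeroAtImInfty wP := by
  have := (Tendsto.mul (Tendsto.mul R0_zero R1_zero) R2_zero)
  unfold IsZeroAtImInfty ZeroAtFilter wP
  simpa using! this

/-- `wP` as a cusp form. -/
def wPc : CuspForm 𝒮ℒ 12 where
  toFun := wP
  slash_action_eq' A hA := by
    obtain ⟨A, rfl⟩ := hA
    exact SlashInvariantForm.slash_action_generators_SL2Z wP_S wP_T A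
  holo' := wP_mdiff
  zero_at_cusps' hc := by
    rw [Subgroup.IsArithmetic.isCusp_iff_isCusp_SL2Z] at hc
    rw [OnePoint.isZeroAt_iff_forall_SL2Z hc]
    intro γ _
    rw [SlashInvariantForm.slash_action_generators_SL2Z wP_S wP_T]
    exact wP_zero

lemma wP_littleO : wP =o[atImInfty] fun τ ↦ Real.exp (-2 * π * τ.im) := by
  have h1 : (fun τ => wR wA1 τ * wR wA2 τ) =o[atImInfty] (fun _ => (1 : ℝ)) := by
    rw [Asymptotics.isLittleO_one_iff]
    simpa using Tendsto.mul R1_zero R2_zero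
  have := R0_decay.mul_isLittleO h1
  simp only [mul_one] at this
  refine this.congr_left fun τ => ?_
  simp [wP, mul_assoc]

lemma wP_eq_zero : wP = 0 := by
  obtain ⟨c, hc⟩ := CuspForm.exists_smul_discriminant_of_weight_eq_twelve wPc
  have h : ∀ τ : ℍ, c * ModularForm.discriminant τ = wP τ := fun τ => by
    have := congrArg (fun f : CuspForm 𝒮ℒ 12 => f τ) hc
    exact this
  by_cases hc0 : c = 0
  · ext τ; rw [← h, hc0]; simp
  exfalso
  have h1 := wP_littleO.trans_isBigO ModularForm.exp_isBigO_discriminant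
  have h2 : ModularForm.discriminant =O[atImInfty] wP := by
    refine Asymptotics.IsBigO.of_bound ‖c⁻¹‖ (Eventually.of_forall fun τ => ?_)
    rw [← h, norm_mul, norm_inv, inv_mul_cancel_left₀ (norm_ne_zero_iff.mpr hc0)]
  have h3 := h1.trans_isBigO h2
  refine Asymptotics.isLittleO_irrefl (Eventually.frequently (Eventually.of_forall fun τ => ?_)) h3
  rw [← h]
  exact mul_ne_zero hc0 (ModularForm.discriminant_ne_zero τ)

lemma R_slash_zero {f g : ℍ → ℂ} (hf : MDiff f) (γ : SL(2, ℤ)) (hfg : f ∣[(2 : ℤ)] γ = g)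
    (h : wR f = 0) : wR g = 0 := by
  rw [← hfg, ← wR_slash hf, h, SlashAction.zero_slash]

lemma R0_R2 : wR wA0 = 0 ∧ wR wA2 = 0 := by
  have h := wP_eq_zero
  rw [wP, UpperHalfPlane.mul_eq_zero_iff ((wR_mdiff wA0_mdiff).mul (wR_mdiff wA1_mdiff))
    (wR_mdiff wA2_mdiff), UpperHalfPlane.mul_eq_zero_iff (wR_mdiff wA0_mdiff)
    (wR_mdiff wA1_mdiff)] at h
  have h1 : wR wA1 = 0 := by
    rcases h with (h | h) | h
    · exact R_slash_zero wA0_mdiff _ wA0_S h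
    · exact h
    · exact R_slash_zero wA2_mdiff _ wA2_T h
  exact ⟨R_slash_zero wA1_mdiff _ wA1_S h1, R_slash_zero wA1_mdiff _ wA1_T h1⟩

/-- The Riccati equation, unfolded, for functions on `ℂ`. -/
lemma riccati_of (F : ℂ → ℂ) (h : wR (fun w : ℍ => F w) = 0) {z : ℂ} (hz : 0 < z.im) :
    6 * ((2 * π * Complex.I)⁻¹ * deriv F z) - wE2 z * F z + 2 * F z ^ 2
      - wE4 ⟨z, hz⟩ = 0 := by
  have h1 := congrFun h ⟨z, hz⟩
  have h2 := D_eq F ⟨z, hz⟩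
  have h3 : wE2 z = EisensteinSeries.E2 ⟨z, hz⟩ := wE2_coe ⟨z, hz⟩
  simp only [wR, Pi.add_apply, Pi.smul_apply, Pi.mul_apply, serreDerivative_apply, h2,
    Pi.zero_apply, smul_eq_mul] at h1
  rw [h3]
  linear_combination h1

lemma riccati0 {z : ℂ} (hz : 0 < z.im) :
    6 * ((2 * π * Complex.I)⁻¹ * deriv wA z) - wE2 z * wA z + 2 * wA z ^ 2
      - wE4 ⟨z, hz⟩ = 0 := riccati_of wA R0_R2.1 hz

/-- the logarithmic derivative of `𝔣⁸`, times 3. -/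
def wB (z : ℂ) : ℂ := -(1 / 2) * wA ((z + (1 : ℝ)) / 2)

lemma riccati2 {z : ℂ} (hz : 0 < z.im) :
    6 * ((2 * π * Complex.I)⁻¹ * deriv wB z) - wE2 z * wB z + 2 * wB z ^ 2
      - wE4 ⟨z, hz⟩ = 0 := riccati_of wB (by have := R0_R2.2; rwa [wA2_eq] at this) hz

lemma norm_cexp_lt {z : ℂ} (hz : 0 < z.im) : ‖Complex.exp (2 * π * Complex.I * z)‖ < 1 :=
  norm_exp_two_pi_I_lt_one ⟨z, hz⟩

lemma sm_geom {p : ℂ} (hp : ‖p‖ < 1) : Summable fun n : ℕ => ‖p ^ n‖ := by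
  simpa using summable_geometric_of_lt_one (norm_nonneg _) hp

lemma mult_add {p : ℂ} (hp : ‖p‖ < 1) : Multipliable fun n : ℕ => 1 + p ^ (n + 1) :=
  multipliable_one_add_of_summable (f := fun n : ℕ => p ^ (n + 1))
    ((sm_geom hp).comp_injective (add_left_injective 1))

lemma mult_odd {p : ℂ} (hp : ‖p‖ < 1) : Multipliable fun n : ℕ => 1 - p ^ (2 * n + 1) := by
  simp_rw [sub_eq_add_neg]
  refine multipliable_one_add_of_summable (f := fun n : ℕ => - p ^ (2 * n + 1)) ?_
  simp_rw [norm_neg]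
  exact (sm_geom hp).comp_injective (i := fun n : ℕ => 2 * n + 1) (fun a b h => by simpa using h)

lemma sq_lt {p : ℂ} (hp : ‖p‖ < 1) : ‖p ^ 2‖ < 1 := by
  rw [norm_pow]; exact pow_lt_one₀ (norm_nonneg _) hp two_ne_zero

lemma prod_add_sub {p : ℂ} (hp : ‖p‖ < 1) :
    (∏' n : ℕ, (1 + p ^ (n + 1))) * ∏' n : ℕ, (1 - p ^ (n + 1)) =
      ∏' n : ℕ, (1 - (p ^ 2) ^ (n + 1)) := by
  rw [← (mult_add hp).tprod_mul (ModularForm.multipliable_one_sub_pow hp)]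
  refine tprod_congr fun n => ?_
  ring

lemma prod_odd_even {p : ℂ} (hp : ‖p‖ < 1) :
    (∏' n : ℕ, (1 - p ^ (2 * n + 1))) * ∏' n : ℕ, (1 - (p ^ 2) ^ (n + 1)) =
      ∏' n : ℕ, (1 - p ^ (n + 1)) := by
  have h := tprod_even_mul_odd (f := fun n : ℕ => 1 - p ^ (n + 1)) (mult_odd hp)
    (by
      have := ModularForm.multipliable_one_sub_pow (sq_lt hp)
      refine this.congr fun n => ?_
      rw [← pow_mul]; ring_nf)
  rw [← h]
  congr 1
  refine tprod_congr fun n => ?_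
  rw [← pow_mul]; ring_nf

lemma phi_ne_zero {z : ℂ} (hz : 0 < z.im) :
    ∏' n : ℕ, (1 - Complex.exp (2 * π * Complex.I * z) ^ (n + 1)) ≠ 0 := by
  have := ModularForm.eta_tprod_ne_zero (z := z) hz
  simpa only [ModularForm.eta_q_eq_pow] using this

lemma eta_eq (z : ℂ) : ModularForm.eta z = Complex.exp (2 * π * Complex.I * z / 24) *
    ∏' n : ℕ, (1 - Complex.exp (2 * π * Complex.I * z) ^ (n + 1)) := by
  simp only [ModularForm.eta, ModularForm.eta_q_eq_pow, Function.Periodic.qParam]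
  norm_num

lemma exp_two (z : ℂ) : Complex.exp (2 * π * Complex.I * (2 * z)) =
    Complex.exp (2 * π * Complex.I * z) ^ 2 := by
  rw [← Complex.exp_nat_mul]; congr 1; push_cast; ring

lemma weberF28_eq {z : ℂ} (hz : 0 < z.im) :
    weberF28 z = (ModularForm.eta (2 * z) / ModularForm.eta z) ^ 8 := by
  have hp := norm_cexp_lt hz
  have h0 := phi_ne_zero hz
  rw [weberF28, (mult_add hp).tprod_pow, eta_eq, eta_eq, exp_two, ← prod_add_sub hp]
  have e1 : Complex.exp (2 * π * Complex.I * (2 * z) / 24) =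
    Complex.exp (2 * π * Complex.I * z / 24) * Complex.exp (2 * π * Complex.I * z / 24) := by
    rw [← Complex.exp_add]; congr 1; ring
  have e2 : Complex.exp (2 * π * Complex.I * z / 3) =
    Complex.exp (2 * π * Complex.I * z / 24) ^ 8 := by
    rw [← Complex.exp_nat_mul]; congr 1; push_cast; ring
  rw [e1, e2]
  have := Complex.exp_ne_zero (2 * π * Complex.I * z / 24)
  rw [← mul_pow]
  congr 1
  field_simp

lemma weberF28_ne_zero {z : ℂ} (hz : 0 < z.im) : weberF28 z ≠ 0 := by
  rw [weberF28_eq hz]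
  exact pow_ne_zero _ (div_ne_zero (ModularForm.eta_ne_zero (im_two_mul hz))
    (ModularForm.eta_ne_zero hz))

lemma eta_hasDeriv {z : ℂ} (hz : 0 < z.im) :
    HasDerivAt ModularForm.eta (π * Complex.I / 12 * wE2 z * ModularForm.eta z) z := by
  have h1 := (ModularForm.differentiableAt_eta_of_mem_upperHalfPlaneSet (z := z) hz).hasDerivAt
  have h2 := ModularForm.logDeriv_eta_eq_E2 ⟨z, hz⟩
  rw [← wE2_coe, logDeriv_apply] at h2
  have h0 := ModularForm.eta_ne_zero (z := z) hz
  change deriv ModularForm.eta z / ModularForm.eta z = π * Complex.I / 12 * wE2 z at h2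
  rw [div_eq_iff h0] at h2
  rwa [h2] at h1

lemma weberF28_hasDeriv {z : ℂ} (hz : 0 < z.im) :
    HasDerivAt weberF28 (2 * π * Complex.I / 3 * wA z * weberF28 z) z := by
  have h1 := eta_hasDeriv hz
  have h2 : HasDerivAt (fun w : ℂ => ModularForm.eta (2 * w)) _ z :=
    (eta_hasDeriv (im_two_mul hz)).comp z ((hasDerivAt_id z).const_mul 2)
  have h0 := ModularForm.eta_ne_zero (z := z) hz
  have h3 := (h2.div h1 h0).pow 8
  have h4 : weberF28 =ᶠ[𝓝 z] fun w => (ModularForm.eta (2 * w) / ModularForm.eta w) ^ 8 := by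
    filter_upwards [isOpen_upperHalfPlaneSet.mem_nhds hz] with w hw
    exact weberF28_eq hw
  refine HasDerivAt.congr_of_eventuallyEq ?_ h4
  refine HasDerivAt.congr_deriv h3 ?_
  rw [weberF28_eq hz, wA]
  simp only [Pi.div_apply, div_pow]
  norm_num only
  field_simp
  ring

lemma weberF8_mul {z : ℂ} (hz : 0 < z.im) :
    weberF8 z * weberF28 ((z + (1 : ℝ)) / 2) = Complex.exp (π * Complex.I / 3) := by
  have hz' : 0 < ((z + (1 : ℝ)) / 2).im := by simpa using hz
  set p := Complex.exp (2 * π * Complex.I * ((z + (1 : ℝ)) / 2)) with hpdef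
  have hp : ‖p‖ < 1 := norm_cexp_lt hz'
  have h0 : ∏' n : ℕ, (1 - p ^ (n + 1)) ≠ 0 := phi_ne_zero hz'
  have hE : (∏' n : ℕ, (1 - p ^ (2 * n + 1))) * (∏' n : ℕ, (1 + p ^ (n + 1))) = 1 := by
    apply mul_right_cancel₀ h0
    rw [mul_assoc, prod_add_sub hp, prod_odd_even hp, one_mul]
  have hterm : ∀ n : ℕ, 1 + Complex.exp (2 * (Real.pi : ℂ) * Complex.I * ((n : ℂ) + 1 / 2) * z) =
      1 - p ^ (2 * n + 1) := by
    intro n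
    rw [hpdef, ← Complex.exp_nat_mul, show ((2 * n + 1 : ℕ) : ℂ) *
      (2 * π * Complex.I * ((z + (1 : ℝ)) / 2)) =
      2 * (Real.pi : ℂ) * Complex.I * ((n : ℂ) + 1 / 2) * z + π * Complex.I
        + n * (2 * π * Complex.I) by push_cast; ring, Complex.exp_add, Complex.exp_add,
      Complex.exp_nat_mul_two_pi_mul_I, Complex.exp_pi_mul_I]
    ring
  rw [weberF8, weberF28, ← hpdef]
  simp_rw [hterm]
  rw [(mult_odd hp).tprod_pow, (mult_add hp).tprod_pow]
  have e : Complex.exp (-(π * Complex.I * z / 3)) *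
      Complex.exp (2 * π * Complex.I * ((z + (1 : ℝ)) / 2) / 3) =
      Complex.exp (π * Complex.I / 3) := by
    rw [← Complex.exp_add]; congr 1; push_cast; ring
  rw [← e]
  rw [mul_mul_mul_comm, ← mul_pow, hE]
  ring

lemma weberF8_eq {z : ℂ} (hz : 0 < z.im) :
    weberF8 z = Complex.exp (π * Complex.I / 3) / weberF28 ((z + (1 : ℝ)) / 2) := by
  have hz' : 0 < ((z + (1 : ℝ)) / 2).im := by simpa using hz
  rw [eq_div_iff (weberF28_ne_zero hz'), weberF8_mul hz]

lemma weberF8_ne_zero {z : ℂ} (hz : 0 < z.im) : weberF8 z ≠ 0 := by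
  intro h
  have := weberF8_mul hz
  rw [h, zero_mul] at this
  exact Complex.exp_ne_zero _ this.symm

lemma weberF8_hasDeriv {z : ℂ} (hz : 0 < z.im) :
    HasDerivAt weberF8 (2 * π * Complex.I / 3 * wB z * weberF8 z) z := by
  have hz' : 0 < ((z + (1 : ℝ)) / 2).im := by simpa using hz
  have h0 := weberF28_ne_zero hz'
  have hl : HasDerivAt (fun w : ℂ => (w + (1 : ℝ)) / 2) (1 / 2) z :=
    ((hasDerivAt_id' z).add_const ((1 : ℝ) : ℂ)).div_const 2
  have h2 : HasDerivAt (fun w : ℂ => weberF28 ((w + (1 : ℝ)) / 2)) _ z :=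
    HasDerivAt.comp (h₂ := weberF28) z (weberF28_hasDeriv hz') hl
  have h3 := (hasDerivAt_const z (Complex.exp (π * Complex.I / 3))).div h2 h0
  have h4 : weberF8 =ᶠ[𝓝 z] fun w => Complex.exp (π * Complex.I / 3) /
      weberF28 ((w + (1 : ℝ)) / 2) := by
    filter_upwards [isOpen_upperHalfPlaneSet.mem_nhds hz] with w hw
    exact weberF8_eq hw
  refine HasDerivAt.congr_of_eventuallyEq ?_ h4
  refine HasDerivAt.congr_deriv h3 ?_
  rw [weberF8_eq hz, wB]
  field_simp
  ring

lemma GTwo_eq {z : ℂ} (hz : 0 < z.im) : GTwo z = -(1 / 12) * wE2 z := by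
  have h1 := EisensteinSeries.E2_eq_tsum_cexp ⟨z, hz⟩
  have h2 := tsum_pow_div_one_sub_eq_tsum_sigma (norm_cexp_lt hz) 1
  have h3 : wE2 z = EisensteinSeries.E2 ⟨z, hz⟩ := wE2_coe ⟨z, hz⟩
  rw [tsum_pnat_eq_tsum_succ (f := fun n : ℕ => (n : ℂ) ^ 1 *
    Complex.exp (2 * π * Complex.I * z) ^ n / (1 - Complex.exp (2 * π * Complex.I * z) ^ n))] at h2
  rw [h3, h1]
  change GTwo z = -(1 / 12) * (1 - 24 * ∑' n : ℕ+, (ArithmeticFunction.sigma 1 n : ℂ) *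
    Complex.exp (2 * π * Complex.I * z) ^ (n : ℕ))
  rw [← h2, GTwo]
  push_cast
  simp only [pow_one]
  ring

lemma GFour_eq {z : ℂ} (hz : 0 < z.im) : GFour z = 1 / 720 * wE4 ⟨z, hz⟩ := by
  have h1 := EisensteinSeries.q_expansion_bernoulli (k := 4) (by norm_num) ⟨2, rfl⟩ ⟨z, hz⟩
  have h2 := tsum_pow_div_one_sub_eq_tsum_sigma (norm_cexp_lt hz) 3
  have hb : bernoulli 4 = -1 / 30 := by decide +kernel
  rw [tsum_pnat_eq_tsum_succ (f := fun n : ℕ => (n : ℂ) ^ 3 *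
    Complex.exp (2 * π * Complex.I * z) ^ n / (1 - Complex.exp (2 * π * Complex.I * z) ^ n))] at h2
  rw [hb] at h1
  have h1' : wE4 ⟨z, hz⟩ = 1 + 240 * ∑' n : ℕ+, (ArithmeticFunction.sigma 3 n : ℂ) *
    Complex.exp (2 * π * Complex.I * z) ^ (n : ℕ) := by
    refine h1.trans ?_
    push_cast
    norm_num
  rw [h1', ← h2, GFour]
  push_cast
  ring

lemma ode_of {y F : ℂ → ℂ}
    (hy : ∀ z : ℂ, 0 < z.im → HasDerivAt y (2 * π * Complex.I / 3 * F z * y z) z)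
    (hF : ∀ z : ℂ, 0 < z.im → DifferentiableAt ℂ F z)
    (hR : ∀ (z : ℂ) (hz : 0 < z.im), 6 * ((2 * π * Complex.I)⁻¹ * deriv F z) - wE2 z * F z
      + 2 * F z ^ 2 - wE4 ⟨z, hz⟩ = 0) (τ : ℂ) (hτ : 0 < τ.im) :
    ramD (ramD y) τ + 2 * GTwo τ * ramD y τ - 40 * GFour τ * y τ = 0 := by
  have hpi : (2 * π * Complex.I : ℂ) ≠ 0 := Complex.two_pi_I_ne_zero
  have h1 : ∀ z : ℂ, 0 < z.im → ramD y z = 1 / 3 * F z * y z := by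
    intro z hz
    rw [ramD, (hy z hz).deriv]
    rw [show 2 * π * Complex.I / 3 * F z * y z = (2 * π * Complex.I) * (1 / 3 * F z * y z) by ring,
      inv_mul_cancel_left₀ hpi]
  have h2 : ramD y =ᶠ[𝓝 τ] fun z => 1 / 3 * F z * y z := by
    filter_upwards [isOpen_upperHalfPlaneSet.mem_nhds hτ] with w hw
    exact h1 w hw
  have h3 : HasDerivAt (fun z => 1 / 3 * F z * y z) _ τ :=
    ((hF τ hτ).hasDerivAt.const_mul (1 / 3)).mul (hy τ hτ)
  have h4 : ramD (ramD y) τ = (2 * π * Complex.I)⁻¹ * deriv (ramD y) τ := rfl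
  rw [h4, h2.deriv_eq, h3.deriv, h1 τ hτ, GTwo_eq hτ, GFour_eq hτ]
  have h5 := hR τ hτ
  have h6 : (2 * π * Complex.I : ℂ)⁻¹ * (2 * π * Complex.I) = 1 := inv_mul_cancel₀ hpi
  linear_combination (1 / 18 * y τ) * h5 + (1 / 9 * F τ ^ 2 * y τ) * h6

lemma wInf_neBot : wInf.NeBot := by
  refine (comap_neBot_iff_frequently).mpr (Frequently.of_forall fun x => ?_)
  exact ⟨x * Complex.I, by simp⟩

lemma wA_ne_wB : ∃ z : ℂ, 0 < z.im ∧ wA z ≠ wB z := by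
  by_contra! h
  have h1 : wA =ᶠ[wInf] wB := by
    have : ∀ᶠ z : ℂ in wInf, 0 < z.im := tendsto_comap.eventually (eventually_gt_atTop 0)
    filter_upwards [this] with z hz using h z hz
  have := wInf_neBot
  have h2 := tendsto_nhds_unique (wA_tendsto.congr' h1) (wA_half_tendsto 1)
  norm_num at h2

lemma wLinInd : LinearIndependent ℂ ![UHP.restrict weberF8, UHP.restrict weberF28] := by
  rw [LinearIndependent.pair_iff]
  intro a b hab
  have h : ∀ z : ℂ, 0 < z.im → a * weberF8 z + b * weberF28 z = 0 := by
    intro z hz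
    have := congrFun hab ⟨z, hz⟩
    exact this
  obtain ⟨z, hz, hne⟩ := wA_ne_wB
  have hd := ((weberF8_hasDeriv hz).const_mul a).add ((weberF28_hasDeriv hz).const_mul b)
  have he : (fun w => a * weberF8 w + b * weberF28 w) =ᶠ[𝓝 z] fun _ => 0 := by
    filter_upwards [isOpen_upperHalfPlaneSet.mem_nhds hz] with w hw
    exact h w hw
  have h0 := hd.unique ((hasDerivAt_const z (0 : ℂ)).congr_of_eventuallyEq he)
  have hpi : (2 * π * Complex.I : ℂ) ≠ 0 := Complex.two_pi_I_ne_zero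
  have h1 : (2 * π * Complex.I) * (b * weberF28 z * (wA z - wB z)) = 0 := by
    linear_combination 3 * h0 - (2 * π * Complex.I) * wB z * h z hz
  have hb : b = 0 := by
    have h2 := weberF28_ne_zero hz
    have h3 := sub_ne_zero.mpr hne
    simpa [hpi, h2, h3] using h1
  have ha := h z hz
  rw [hb, zero_mul, add_zero] at ha
  exact ⟨(mul_eq_zero.mp ha).resolve_right (weberF8_ne_zero hz), hb⟩

lemma wOde8 (τ : ℂ) (hτ : 0 < τ.im) :
    ramD (ramD weberF8) τ + 2 * GTwo τ * ramD weberF8 τ - 40 * GFour τ * weberF8 τ = 0 :=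
  ode_of (F := wB) (fun _ hz => weberF8_hasDeriv hz) (fun _ hz => wAh_diff 1 hz)
    (fun _ hz => riccati2 hz) τ hτ

lemma wOde28 (τ : ℂ) (hτ : 0 < τ.im) :
    ramD (ramD weberF28) τ + 2 * GTwo τ * ramD weberF28 τ - 40 * GFour τ * weberF28 τ = 0 :=
  ode_of (F := wA) (fun _ hz => weberF28_hasDeriv hz) (fun _ hz => wA_diff hz)
    (fun _ hz => riccati0 hz) τ hτ

end
end Weber

/-- `𝔣⁸` and `𝔣₂⁸` are linearly independent over `ℂ` and form a
fundamental system of solutions of `Θ²y − 40·G₄ y = 0`, i.e. each satisfies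
`(q d/dq)²y + 2·G₂·(q d/dq)y − 40·G₄·y = 0` on `ℍ`. -/
theorem stmt_15 :
    LinearIndependent ℂ ![UHP.restrict weberF8, UHP.restrict weberF28] ∧
    (∀ τ : ℂ, 0 < τ.im →
      ramD (ramD weberF8) τ + 2 * GTwo τ * ramD weberF8 τ - 40 * GFour τ * weberF8 τ = 0) ∧
    (∀ τ : ℂ, 0 < τ.im →
      ramD (ramD weberF28) τ + 2 * GTwo τ * ramD weberF28 τ - 40 * GFour τ * weberF28 τ = 0) := by
  exact ⟨wLinInd, wOde8, wOde28⟩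
end
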